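/- There exists a compact set A ⊆ ℝ³ homeomorphic to the unit interval [0,1] which is not an attractor for any discrete dynamical system: for every open set U ⊆ ℝ³ containing A and every injective continuous map f : U → U, A is not an attractor for f. -/

import Mathlib

open Set

noncomputable section

/-- Euclidean 3-space. -/
abbrev R3 := EuclideanSpace ℝ (Fin 3)

/-- The image in `ℝ³` of a set `P ⊆ ℝ³` under the `n`-th iterate of a map `f : U → U`
defined on (the subtype of) an open set `U ⊆ ℝ³`. -/
def imgIter {U : Set R3} (f : U → U) (n : ℕ) (P : Set R3) : Set R3 :=
  Subtype.val '' (f^[n] '' (Subtype.val ⁻¹' P))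

/-- A compact set `P` is attracted by `K` under `f : U → U` if for every neighbourhood `V`
of `K` there is `n₀` such that `fⁿ(P) ⊆ V` for all `n ≥ n₀`. -/
def IsAttracted {U : Set R3} (f : U → U) (K P : Set R3) : Prop :=
  ∀ V : Set R3, K ⊆ interior V → ∃ n₀ : ℕ, ∀ n ≥ n₀, imgIter f n P ⊆ V

/-- `K` is an attractor for the discrete dynamical system `f : U → U`: it is compact,
invariant (`f(K) = K`), and has a neighbourhood `A ⊆ U` all of whose compact subsets
are attracted by `K`. -/
def IsAttractor {U : Set R3} (f : U → U) (K : Set R3) : Prop :=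
  IsCompact K ∧ K ⊆ U ∧ imgIter f 1 K = K ∧
    ∃ A : Set R3, A ⊆ U ∧ K ⊆ interior A ∧
      ∀ P : Set R3, IsCompact P → P ⊆ A → IsAttracted f K P

/-- Evaluating `det (1 + t A)` at `t = 1` by interpolation at `finrank + 1` nodes. -/
theorem det_one_add_eq_sum_lagrange {E : Type*} [NormedAddCommGroup E] [NormedSpace ℝ E]
    [FiniteDimensional ℝ E] (v : ℕ → ℝ) (hv : Function.Injective v) (A : E →L[ℝ] E) :
    (1 + A).det = ∑ i ∈ Finset.range (Module.finrank ℝ E + 1),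
      (Lagrange.basis (Finset.range (Module.finrank ℝ E + 1)) v i).eval 1 * (1 + v i • A).det := by
  classical
  let b := Module.finBasis ℝ E
  let M := LinearMap.toMatrix b b (A : E →ₗ[ℝ] E)
  let p : Polynomial ℝ := Matrix.det ((Polynomial.X : Polynomial ℝ) • M.map Polynomial.C +
    (1 : Matrix (Fin (Module.finrank ℝ E)) (Fin (Module.finrank ℝ E)) ℝ).map Polynomial.C)
  have hp : ∀ t : ℝ, (1 + t • A).det = p.eval t := by
    intro t
    have : (1 + t • A).det = LinearMap.det ((1 + t • A : E →L[ℝ] E) : E →ₗ[ℝ] E) := rfl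
    rw [this, ← LinearMap.det_toMatrix b]
    have h2 : LinearMap.toMatrix b b ((1 + t • A : E →L[ℝ] E) : E →ₗ[ℝ] E) = 1 + t • M := by
      have : ((1 + t • A : E →L[ℝ] E) : E →ₗ[ℝ] E) = 1 + t • (A : E →ₗ[ℝ] E) := rfl
      rw [this, map_add, map_smul, LinearMap.toMatrix_one]
    rw [h2]
    change _ = (Polynomial.evalRingHom t) _
    rw [RingHom.map_det]
    congr 1
    ext i j
    by_cases hij : i = j <;> simp [hij, add_comm, mul_comm t]
  have hdeg : p.degree < (Finset.range (Module.finrank ℝ E + 1)).card := by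
    have := Polynomial.natDegree_det_X_add_C_le M 1
    rw [Finset.card_range]
    refine lt_of_le_of_lt Polynomial.degree_le_natDegree ?_
    rw [Nat.cast_lt]
    rw [Fintype.card_fin] at this
    exact Nat.lt_succ_of_le this
  have hL := Lagrange.eq_interpolate_of_eval_eq (fun i => p.eval (v i))
    (hv.injOn (s := ↑(Finset.range (Module.finrank ℝ E + 1)))) hdeg (fun i _ => rfl)
  have h1 := hp 1
  rw [one_smul] at h1
  rw [h1]
  conv_lhs => rw [hL]
  rw [Lagrange.interpolate_apply, Polynomial.eval_finsetSum]
  refine Finset.sum_congr rfl fun i _ => ?_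
  rw [hp, Polynomial.eval_mul, Polynomial.eval_C, mul_comm]

theorem exists_norm_eq_on_segment {E : Type*} [NormedAddCommGroup E] [NormedSpace ℝ E]
    {x y : E} (hx : ‖x‖ ≤ 1) (hy : 1 ≤ ‖y‖) : ∃ z, ‖z‖ = 1 ∧ dist x z ≤ dist x y := by
  have hc : ContinuousOn (fun t : ℝ => ‖x + t • (y - x)‖) (Icc 0 1) := by fun_prop
  have := intermediate_value_Icc zero_le_one hc
  obtain ⟨t, ht, h⟩ := this (show (1 : ℝ) ∈ _ by simp [hx, hy])
  refine ⟨_, h, ?_⟩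
  rw [dist_eq_norm, dist_eq_norm]
  have : x - (x + t • (y - x)) = t • (x - y) := by rw [smul_sub, smul_sub]; abel
  rw [this, norm_smul, Real.norm_eq_abs, abs_of_nonneg ht.1]
  exact mul_le_of_le_one_left (norm_nonneg _) ht.2

/-- A Lipschitz function on the closed unit ball vanishing on the sphere extends by zero. -/
theorem lipschitzWith_indicator_closedBall {E : Type*} [NormedAddCommGroup E] [NormedSpace ℝ E]
    {k : E → E} {K : NNReal} (hk : LipschitzOnWith K k (Metric.closedBall 0 1))
    (h0 : ∀ x, ‖x‖ = 1 → k x = 0) :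
    LipschitzWith K ((Metric.closedBall (0 : E) 1).indicator k) := by
  have key : ∀ x y : E, ‖x‖ ≤ 1 → 1 < ‖y‖ → dist (k x) 0 ≤ K * dist x y := by
    intro x y hx hy
    obtain ⟨z, hz, hd⟩ := exists_norm_eq_on_segment hx hy.le
    rw [← h0 z hz]
    exact (hk.dist_le_mul x (by simpa using hx) z (by simp [hz])).trans (by gcongr)
  refine LipschitzWith.of_dist_le_mul fun x y => ?_
  by_cases hx : ‖x‖ ≤ 1 <;> by_cases hy : ‖y‖ ≤ 1
  · simpa [indicator, hx, hy] using hk.dist_le_mul x (by simpa using hx) y (by simpa using hy)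
  · simpa [indicator, hx, hy] using key x y hx (not_le.1 hy)
  · simpa [indicator, hx, hy, dist_comm] using key y x hy (not_le.1 hx)
  · simp only [indicator, hx, hy, mem_closedBall_zero_iff, if_false, dist_self]
    positivity

theorem det_eq_zero_of_inner_eq_zero {E : Type*} [NormedAddCommGroup E] [InnerProductSpace ℝ E]
    [FiniteDimensional ℝ E] (A : E →L[ℝ] E) {w : E} (hw : w ≠ 0)
    (h : ∀ v, inner ℝ w (A v) = 0) : A.det = 0 := by
  by_contra hne
  have : Function.Surjective (A : E →ₗ[ℝ] E) :=
    (LinearMap.equivOfDetNeZero (A : E →ₗ[ℝ] E) hne).surjective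
  obtain ⟨v, hv⟩ := this w
  have h1 := h v
  have : A v = w := hv
  rw [this] at h1
  exact hw (inner_self_eq_zero.1 h1)

open MeasureTheory in
/-- There is no `C¹` retraction of the closed unit ball onto its boundary sphere. -/
theorem no_smooth_retraction {E : Type*} [NormedAddCommGroup E] [InnerProductSpace ℝ E]
    [FiniteDimensional ℝ E] {W : Set E} (hW : IsOpen W) (hBW : Metric.closedBall 0 1 ⊆ W)
    {g : E → E} (hg : ContDiffOn ℝ 1 g W) (hid : ∀ x, ‖x‖ = 1 → g x = x)
    (hn : ∀ x, ‖x‖ ≤ 1 → ‖g x‖ = 1) : False := by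
  let _ : MeasurableSpace E := borel E
  have _ : BorelSpace E := ⟨rfl⟩
  let μ : Measure E := Measure.addHaar
  let B := Metric.ball (0 : E) 1
  let CB := Metric.closedBall (0 : E) 1
  have hBCB : B ⊆ CB := Metric.ball_subset_closedBall
  have hdiff : ∀ x ∈ W, DifferentiableAt ℝ g x := fun x hx =>
    (hg.differentiableOn one_ne_zero).differentiableAt (hW.mem_nhds hx)
  have hcont : ContinuousOn (fderiv ℝ g) W := hg.continuousOn_fderiv_of_isOpen hW le_rfl
  let D : E → E →L[ℝ] E := fun x => fderiv ℝ g x - 1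
  have hD : ContinuousOn D W := hcont.sub continuousOn_const
  obtain ⟨C, hC⟩ : ∃ C, ∀ x ∈ CB, ‖D x‖ ≤ C :=
    (isCompact_closedBall (0 : E) 1).exists_bound_of_continuousOn (hD.mono hBW)
  have hC0 : 0 ≤ C := (norm_nonneg _).trans (hC 0 (by simp [CB]))
  let k0 : E → E := fun x => g x - x
  have hk0 : ∀ x ∈ W, HasFDerivAt k0 (D x) x := fun x hx =>
    (hdiff x hx).hasFDerivAt.sub (hasFDerivAt_id x)
  have hlip0 : LipschitzOnWith C.toNNReal k0 CB := by
    refine (convex_closedBall 0 1).lipschitzOnWith_of_nnnorm_hasFDerivWithin_le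
      (fun x hx => (hk0 x (hBW hx)).hasFDerivWithinAt) fun x hx => ?_
    rw [← NNReal.coe_le_coe, coe_nnnorm, Real.coe_toNNReal _ hC0]
    exact hC x hx
  have hlip := lipschitzWith_indicator_closedBall hlip0
    (fun x hx => by simp [k0, hid x hx])
  set k := CB.indicator k0 with hk
  -- the invertible linear maps near the identity have positive determinant
  obtain ⟨δ, hδ, hdet⟩ : ∃ δ > 0, ∀ A : E →L[ℝ] E, ‖A‖ < δ → 0 < (1 + A).det := by
    have hc : Continuous fun A : E →L[ℝ] E => (1 + A).det :=
      ContinuousLinearMap.continuous_det.comp (continuous_const.add continuous_id)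
    have h0 : (0 : ℝ) < (1 + (0 : E →L[ℝ] E)).det := by
      rw [add_zero]
      have : (1 : E →L[ℝ] E).det = LinearMap.det (1 : E →ₗ[ℝ] E) := rfl
      rw [this, map_one]; exact one_pos
    obtain ⟨δ, hδ, h⟩ := Metric.eventually_nhds_iff.1
      (hc.continuousAt.eventually (lt_mem_nhds h0))
    exact ⟨δ, hδ, fun A hA => h (by simpa using hA)⟩
  have hdetmeas : ∀ t : ℝ, ContinuousOn (fun x => (1 + t • D x).det) CB := fun t =>
    ContinuousLinearMap.continuous_det.comp_continuousOn
      (continuousOn_const.add ((hD.mono hBW).const_smul t))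
  have hint : ∀ t : ℝ, IntegrableOn (fun x => (1 + t • D x).det) B μ := fun t =>
    ((hdetmeas t).integrableOn_compact (isCompact_closedBall 0 1)).mono_set hBCB
  -- for small times the map is a homeomorphism preserving the ball
  have hvol : ∀ t : ℝ, 0 < t → t * C < 1 → t * C < δ →
      ∫ x in B, (1 + t • D x).det ∂μ = μ.real B := by
    intro t ht ht1 ht2
    let h : E → E := fun x => x + t • k x
    have happ : ApproximatesLinearOn h ((ContinuousLinearEquiv.refl ℝ E : E ≃L[ℝ] E) : E →L[ℝ] E)
        univ (t.toNNReal * C.toNNReal) := by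
      intro x _ y _
      have : h x - h y - ((ContinuousLinearEquiv.refl ℝ E : E ≃L[ℝ] E) : E →L[ℝ] E) (x - y)
          = t • (k x - k y) := by
        simp only [h, ContinuousLinearEquiv.coe_refl, ContinuousLinearMap.coe_id', id, smul_sub]
        abel
      rw [this, norm_smul, Real.norm_eq_abs, abs_of_pos ht, NNReal.coe_mul, mul_assoc,
        Real.coe_toNNReal _ ht.le]
      gcongr
      simpa [dist_eq_norm] using hlip.dist_le_mul x y
    have hsmall : Subsingleton E ∨ t.toNNReal * C.toNNReal <
        ‖(((ContinuousLinearEquiv.refl ℝ E : E ≃L[ℝ] E)).symm : E →L[ℝ] E)‖₊⁻¹ := by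
      rcases subsingleton_or_nontrivial E with h | h
      · exact Or.inl h
      · right
        have : ‖(((ContinuousLinearEquiv.refl ℝ E : E ≃L[ℝ] E)).symm : E →L[ℝ] E)‖₊ = 1 := by
          rw [← NNReal.coe_inj]
          exact ContinuousLinearMap.norm_id
        rw [this, inv_one, ← NNReal.coe_lt_coe]
        simpa [Real.coe_toNNReal _ ht.le, Real.coe_toNNReal _ hC0] using ht1
    have hinj : Function.Injective h := by
      have := (happ.toHomeomorph h hsmall).injective
      exact this
    have hsurj : Function.Surjective h := (happ.toHomeomorph h hsmall).surjective
    have hfix : ∀ x ∉ B, h x = x := by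
      intro x hx
      have hx' : 1 ≤ ‖x‖ := by simpa [B] using hx
      have : k x = 0 := by
        rcases hx'.eq_or_lt with h1 | h1
        · rw [hk, indicator_of_mem (by simp [CB, h1.symm])]
          simp [k0, hid x h1.symm]
        · rw [hk, indicator_of_notMem (by simpa [CB] using h1)]
      simp [h, this]
    have himg : h '' B = B := by
      apply Subset.antisymm
      · rintro _ ⟨x, hx, rfl⟩
        by_contra hne
        exact hne ((hinj (hfix _ hne)).symm ▸ hx)
      · intro y hy
        obtain ⟨x, rfl⟩ := hsurj y
        refine ⟨x, ?_, rfl⟩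
        by_contra hne
        exact hne (hfix x hne ▸ hy)
    have hder : ∀ x ∈ B, HasFDerivWithinAt h (1 + t • D x) B x := by
      intro x hx
      have h1 : HasFDerivAt (fun x => x + t • k0 x) (1 + t • D x) x :=
        (hasFDerivAt_id x).add ((hk0 x (hBW (hBCB hx))).const_smul t)
      refine h1.hasFDerivWithinAt.congr (fun y hy => ?_) ?_
      · simp [h, hk, indicator_of_mem (hBCB hy)]
      · simp [h, hk, indicator_of_mem (hBCB hx)]
    have hmain := lintegral_abs_det_fderiv_eq_addHaar_image μ Metric.isOpen_ball.measurableSet hder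
      hinj.injOn
    rw [himg] at hmain
    have hpos : ∀ x ∈ B, 0 < (1 + t • D x).det := fun x hx => by
      refine hdet _ (lt_of_le_of_lt ?_ ht2)
      rw [norm_smul, Real.norm_eq_abs, abs_of_pos ht]
      gcongr
      exact hC x (hBCB hx)
    rw [integral_eq_lintegral_of_nonneg_ae, Measure.real, ← hmain]
    · congr 1
      refine setLIntegral_congr_fun Metric.isOpen_ball.measurableSet fun x hx => ?_
      simp only [abs_of_pos (hpos x hx)]
    · exact (ae_restrict_iff' Metric.isOpen_ball.measurableSet).2
        (Filter.Eventually.of_forall fun x hx => (hpos x hx).le)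
    · exact (hint t).aestronglyMeasurable
  -- at time one the determinant vanishes
  have hzero : ∀ x ∈ B, (1 + D x).det = 0 := by
    intro x hx
    have hx' : ‖g x‖ = 1 := hn x (by simpa [CB] using hBCB hx)
    have hAg : HasFDerivAt g (1 + D x) x := by
      have : 1 + D x = fderiv ℝ g x := by simp [D]
      rw [this]; exact (hdiff x (hBW (hBCB hx))).hasFDerivAt
    refine det_eq_zero_of_inner_eq_zero _ (w := g x)
      (by rw [← norm_ne_zero_iff, hx']; exact one_ne_zero) fun v => ?_
    have h2 := hAg.inner ℝ hAg
    have h3 : (fun y => inner ℝ (g y) (g y)) =ᶠ[nhds x] fun _ => (1 : ℝ) := by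
      filter_upwards [Metric.isOpen_ball.mem_nhds hx] with y hy
      rw [real_inner_self_eq_norm_sq, hn y (by simpa [CB] using hBCB hy), one_pow]
    have h4 := (h2.congr_of_eventuallyEq h3.symm).unique (hasFDerivAt_const (1 : ℝ) x)
    have h5 := congrArg (fun T : E →L[ℝ] ℝ => T v) h4
    simp only [fderivInnerCLM_apply, ContinuousLinearMap.comp_apply,
      ContinuousLinearMap.prod_apply, zero_apply] at h5
    rw [real_inner_comm (g x) ((1 + D x) v)] at h5
    linarith
  obtain ⟨s, hs0, hs1, hs2⟩ : ∃ s > 0, s * C < 1 ∧ s * C < δ := by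
    refine ⟨min 1 δ / (C + 1), by positivity, ?_, ?_⟩
    · rw [div_mul_eq_mul_div, div_lt_iff₀ (by positivity)]
      nlinarith [min_le_left 1 δ, lt_min one_pos hδ]
    · rw [div_mul_eq_mul_div, div_lt_iff₀ (by positivity)]
      nlinarith [min_le_right 1 δ, lt_min one_pos hδ]
  let v : ℕ → ℝ := fun i => s / (i + 1)
  have hv : Function.Injective v := by
    intro i j hij
    have : ((i : ℝ) + 1) = j + 1 := by
      have h' : s / ((i : ℝ) + 1) = s / (j + 1) := hij
      rw [div_eq_div_iff (by positivity) (by positivity)] at h'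
      exact (mul_left_cancel₀ hs0.ne' h').symm
    exact_mod_cast add_right_cancel this
  have hvv : ∀ i, ∫ x in B, (1 + v i • D x).det ∂μ = μ.real B := by
    intro i
    have h1 : v i ≤ s := div_le_self hs0.le (by linarith [(Nat.cast_nonneg i : (0 : ℝ) ≤ i)])
    have h2 : v i * C ≤ s * C := by gcongr
    exact hvol _ (by positivity) (by linarith) (by linarith)
  have hfin : ∫ x in B, (1 + D x).det ∂μ = μ.real B := by
    rw [funext fun x => det_one_add_eq_sum_lagrange v hv (D x)]
    rw [integral_finsetSum _ fun i _ => (hint (v i)).const_mul _]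
    simp_rw [integral_const_mul, hvv]
    rw [← Finset.sum_mul, ← Polynomial.eval_finsetSum,
      Lagrange.sum_basis hv.injOn Finset.nonempty_range_add_one, Polynomial.eval_one, one_mul]
  rw [setIntegral_congr_fun Metric.isOpen_ball.measurableSet hzero, integral_zero] at hfin
  have : 0 < μ.real B := by
    refine ENNReal.toReal_pos (Metric.measure_ball_pos μ 0 one_pos).ne' ?_
    exact measure_ball_lt_top.ne
  linarith

theorem exists_fixedPoint_of_contDiff {E : Type*} [NormedAddCommGroup E] [InnerProductSpace ℝ E]
    [FiniteDimensional ℝ E] {p : E → E} (hp : ContDiff ℝ 1 p)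
    (hmaps : ∀ x, ‖x‖ ≤ 1 → ‖p x‖ ≤ 1) : ∃ x, ‖x‖ ≤ 1 ∧ p x = x := by
  by_contra! hne
  let u : E → E := fun x => x - p x
  have hu : ContDiff ℝ 1 u := contDiff_id.sub hp
  let s : E → ℝ := fun x => inner ℝ x (u x)
  have hs : ContDiff ℝ 1 s := contDiff_id.inner ℝ hu
  let d : E → ℝ := fun x => s x ^ 2 + ‖u x‖ ^ 2 * (1 - ‖x‖ ^ 2)
  have hd : ContDiff ℝ 1 d :=
    (hs.pow 2).add ((hu.norm_sq ℝ).mul (contDiff_const.sub (contDiff_id.norm_sq ℝ)))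
  have hu0 : ∀ x, ‖x‖ ≤ 1 → 0 < ‖u x‖ := fun x hx =>
    norm_pos_iff.2 (sub_ne_zero.2 (hne x hx).symm)
  have hsphere : ∀ x, ‖x‖ = 1 → 0 < s x := by
    intro x hx
    have h1 : ‖p x‖ ≤ 1 := hmaps x hx.le
    have h2 : ‖u x‖ ^ 2 = ‖x‖ ^ 2 - 2 * inner ℝ x (p x) + ‖p x‖ ^ 2 := norm_sub_sq_real x (p x)
    have h3 : s x = ‖x‖ ^ 2 - inner ℝ x (p x) := by
      simp only [s, u, inner_sub_right, real_inner_self_eq_norm_sq]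
    have h4 := hu0 x hx.le
    rw [hx] at h2 h3
    nlinarith [norm_nonneg (p x)]
  have hd0 : ∀ x, ‖x‖ ≤ 1 → 0 < d x := by
    intro x hx
    rcases hx.eq_or_lt with h | h
    · have := hsphere x h
      simp only [d, h]
      nlinarith
    · have := hu0 x hx
      have h1 : 0 < 1 - ‖x‖ ^ 2 := by nlinarith [norm_nonneg x]
      positivity
  let W : Set E := {x | 0 < ‖u x‖ ∧ 0 < d x}
  have hW : IsOpen W := (isOpen_lt continuous_const hu.continuous.norm).inter
    (isOpen_lt continuous_const hd.continuous)
  let l : E → ℝ := fun x => (-s x + √(d x)) / ‖u x‖ ^ 2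
  have hl : ContDiffOn ℝ 1 l W := by
    refine ((hs.neg.contDiffOn).add (hd.contDiffOn.sqrt fun x hx => hx.2.ne')).div
      (hu.norm_sq ℝ).contDiffOn fun x hx => ?_
    have := hx.1
    positivity
  refine no_smooth_retraction hW (g := fun x => x + l x • u x) (fun x hx => ?_)
    (contDiffOn_id.add (hl.smul hu.contDiffOn)) (fun x hx => ?_) fun x hx => ?_
  · have hx' : ‖x‖ ≤ 1 := by simpa using hx
    exact ⟨hu0 x hx', hd0 x hx'⟩
  · have h : d x = s x ^ 2 := by simp [d, hx]
    have : l x = 0 := by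
      simp only [l, h, Real.sqrt_sq (hsphere x hx).le]
      simp
    simp [this]
  · have h1 : ‖x + l x • u x‖ ^ 2 = ‖x‖ ^ 2 + 2 * (l x * s x) + l x ^ 2 * ‖u x‖ ^ 2 := by
      rw [norm_add_sq_real, inner_smul_right, norm_smul, mul_pow, Real.norm_eq_abs, sq_abs]
    have h2 : l x * ‖u x‖ ^ 2 = -s x + √(d x) :=
      div_mul_cancel₀ _ (pow_ne_zero 2 (hu0 x hx).ne')
    have h3 : √(d x) ^ 2 = s x ^ 2 + ‖u x‖ ^ 2 * (1 - ‖x‖ ^ 2) := Real.sq_sqrt (hd0 x hx).le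
    have h4 : ‖u x‖ ^ 2 * (‖x + l x • u x‖ ^ 2 - 1) = 0 := by
      rw [h1]
      have : √(d x) = l x * ‖u x‖ ^ 2 + s x := by linarith
      rw [this] at h3
      linarith
    have h5 : ‖x + l x • u x‖ ^ 2 = 1 := by
      rcases mul_eq_zero.1 h4 with h | h
      · exact absurd h (pow_ne_zero 2 (hu0 x hx).ne')
      · linarith
    exact (pow_eq_one_iff_of_nonneg (norm_nonneg _) two_ne_zero).1 h5

/-- The **Brouwer fixed point theorem** for the closed unit ball. -/
theorem exists_fixedPoint_closedBall {E : Type*} [NormedAddCommGroup E] [InnerProductSpace ℝ E]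
    [FiniteDimensional ℝ E] {p : E → E} (hp : ContinuousOn p (Metric.closedBall 0 1))
    (hmaps : MapsTo p (Metric.closedBall 0 1) (Metric.closedBall 0 1)) :
    ∃ x ∈ Metric.closedBall (0 : E) 1, p x = x := by
  by_contra! hne
  obtain ⟨ε, hε, hmin⟩ : ∃ ε > 0, ∀ x ∈ Metric.closedBall (0 : E) 1, ε ≤ ‖p x - x‖ := by
    obtain ⟨x, hx, h⟩ := (isCompact_closedBall (0 : E) 1).exists_isMinOn ⟨0, by simp⟩
      (hp.sub continuousOn_id).norm
    exact ⟨_, norm_pos_iff.2 (sub_ne_zero.2 (hne x hx)), fun y hy => h hy⟩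
  let r : E → E := fun x => (max 1 ‖x‖)⁻¹ • x
  have hpos : ∀ x : E, 0 < max 1 ‖x‖ := fun x => lt_max_of_lt_left one_pos
  have hr : Continuous r :=
    ((continuous_const.max continuous_norm).inv₀ fun x => (hpos x).ne').smul continuous_id
  have hrB : ∀ x, r x ∈ Metric.closedBall (0 : E) 1 := by
    intro x
    rw [mem_closedBall_zero_iff, norm_smul, norm_inv, Real.norm_of_nonneg (hpos x).le,
      inv_mul_le_iff₀ (hpos x), mul_one]
    exact le_max_right _ _
  have hrid : ∀ x : E, ‖x‖ ≤ 1 → r x = x := fun x hx => by simp [r, max_eq_left hx]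
  have hP : Continuous (p ∘ r) := hp.comp_continuous hr hrB
  obtain ⟨q, hq, hqP, -⟩ := hP.exists_contDiff_approx 1 (continuous_const (y := ε / 3))
    fun _ => by positivity
  have hPn : ∀ x, ‖p (r x)‖ ≤ 1 := fun x => by simpa using hmaps (hrB x)
  have hqn : ∀ x, ‖q x‖ ≤ 1 + ε / 3 := fun x => by
    have := norm_le_norm_add_norm_sub' (q x) (p (r x))
    have h2 := hqP x
    rw [dist_eq_norm] at h2
    linarith [hPn x, show ‖q x - p (r x)‖ < ε / 3 from h2]
  obtain ⟨x, hx, hfix⟩ := exists_fixedPoint_of_contDiff (p := fun x => (1 + ε / 3)⁻¹ • q x)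
    (contDiff_const.smul hq) fun x _ => by
      rw [norm_smul, norm_inv, Real.norm_of_nonneg (by positivity),
        inv_mul_le_iff₀ (by positivity), mul_one]
      exact hqn x
  have h1 : q x = (1 + ε / 3) • x := by
    rw [← hfix, smul_smul, mul_inv_cancel₀ (by positivity), one_smul, hfix]
  have h2 : ‖q x - p x‖ < ε / 3 := by
    have := hqP x
    rwa [dist_eq_norm, Function.comp_apply, hrid x hx] at this
  have h3 : p x - x = (p x - q x) + (ε / 3) • x := by
    rw [h1, add_smul, one_smul]; abel
  have h4 := hmin x (by simpa using hx)
  rw [h3] at h4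
  have h5 := norm_add_le (p x - q x) ((ε / 3) • x)
  rw [norm_sub_rev, norm_smul, Real.norm_of_nonneg (by positivity)] at h5
  nlinarith

/-- A continuous injection of the closed unit ball has a continuous left inverse defined on the
whole space. -/
theorem exists_continuous_leftInverse {E : Type*} [NormedAddCommGroup E] [InnerProductSpace ℝ E]
    [FiniteDimensional ℝ E] {K : Set E} (hK : IsCompact K) {f : E → E} (hf : ContinuousOn f K)
    (hinj : InjOn f K) : ∃ G : E → E, Continuous G ∧ ∀ x ∈ K, G (f x) = x := by
  have : CompactSpace K := isCompact_iff_compactSpace.1 hK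
  have he : Topology.IsClosedEmbedding (K.domRestrict f) :=
    hf.domRestrict.isClosedEmbedding (injOn_iff_injective.1 hinj)
  obtain ⟨G, hG⟩ := ContinuousMap.exists_extension' he
    (⟨Subtype.val, continuous_subtype_val⟩ : C(K, E))
  exact ⟨G, G.continuous, fun x hx => congrFun hG ⟨x, hx⟩⟩

open MeasureTheory in
/-- A map of class `C¹` can be moved off zero on a sphere by an arbitrarily small translation. -/
theorem exists_small_sub_ne_zero {E : Type*} [NormedAddCommGroup E] [InnerProductSpace ℝ E]
    [FiniteDimensional ℝ E] {P : E → E} (hP : ContDiff ℝ 1 P) (c : E) {ε δ : ℝ} (hε : ε ≠ 0)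
    (hδ : 0 < δ) : ∃ a : E, ‖a‖ < δ ∧ ∀ y ∈ Metric.sphere c ε, P y - a ≠ 0 := by
  let _ : MeasurableSpace E := borel E
  have _ : BorelSpace E := ⟨rfl⟩
  have h0 : (Measure.addHaar : Measure E) (P '' Metric.sphere c ε) = 0 :=
    addHaar_image_eq_zero_of_differentiableOn_of_addHaar_eq_zero _
      (hP.differentiable one_ne_zero).differentiableOn (Measure.addHaar_sphere_of_ne_zero _ c hε)
  by_contra! h
  have hsub : Metric.ball (0 : E) δ ⊆ P '' Metric.sphere c ε := by
    intro a ha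
    obtain ⟨y, hy, hya⟩ := h a (by simpa using ha)
    exact ⟨y, hy, sub_eq_zero.1 hya⟩
  exact (Metric.measure_ball_pos Measure.addHaar (0 : E) hδ).ne' (measure_mono_null hsub h0)

/-- A continuous injection of the closed unit ball sends the centre to an interior point of the
image. -/
theorem apply_zero_mem_interior_image {E : Type*} [NormedAddCommGroup E] [InnerProductSpace ℝ E]
    [FiniteDimensional ℝ E] {f : E → E} (hf : ContinuousOn f (Metric.closedBall 0 1))
    (hinj : InjOn f (Metric.closedBall 0 1)) :
    f 0 ∈ interior (f '' Metric.closedBall 0 1) := by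
  set K := f '' Metric.closedBall 0 1 with hKdef
  have hK : IsCompact K := (isCompact_closedBall 0 1).image_of_continuousOn hf
  obtain ⟨G, hG, hGf⟩ := exists_continuous_leftInverse (isCompact_closedBall 0 1) hf hinj
  have stable : ∀ H : E → E, ContinuousOn H K → (∀ y ∈ K, ‖G y - H y‖ ≤ 1) →
      ∃ y ∈ K, H y = 0 := by
    intro H hH hb
    obtain ⟨x, hx, hfix⟩ := exists_fixedPoint_closedBall (p := fun x => x - H (f x))
      (continuousOn_id.sub (hH.comp hf (mapsTo_image _ _))) fun x hx => by
        have := hb (f x) (mem_image_of_mem f hx)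
        rw [hGf x hx] at this
        simpa using this
    exact ⟨f x, mem_image_of_mem f hx, by simpa using hfix⟩
  have h0B : (0 : E) ∈ Metric.closedBall (0 : E) 1 := by simp
  have hG0 : G (f 0) = 0 := hGf 0 h0B
  have hGzero : ∀ y ∈ K, G y = 0 → y = f 0 := by
    rintro _ ⟨x, hx, rfl⟩ h
    rw [hGf x hx] at h
    rw [h]
  by_contra hnot
  obtain ⟨η, hη, hsmall⟩ := Metric.continuous_iff.1 hG (f 0) (1 / 10) (by norm_num)
  rw [hG0] at hsmall
  set ε := η / 2 with hεdef
  have hε : 0 < ε := by positivity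
  obtain ⟨c, hcK, hc⟩ : ∃ c ∉ K, dist c (f 0) < ε := by
    by_contra! h
    exact hnot (mem_interior_iff_mem_nhds.2 (Metric.mem_nhds_iff.2
      ⟨ε, hε, fun y hy => by_contra fun hyK => (h y hyK).not_gt hy⟩))
  let Q : Set E := K ∩ {y | ε ≤ dist y c}
  have hQ : IsCompact Q := hK.inter_right (isClosed_le continuous_const (by fun_prop))
  obtain ⟨m, hm, hQm⟩ : ∃ m > 0, ∀ y ∈ Q, m ≤ ‖G y‖ := by
    rcases Q.eq_empty_or_nonempty with h | h
    · exact ⟨1, one_pos, by simp [h]⟩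
    · obtain ⟨y, hy, hmin⟩ := hQ.exists_isMinOn h hG.norm.continuousOn
      refine ⟨‖G y‖, norm_pos_iff.2 fun h0 => ?_, fun z hz => hmin hz⟩
      have h1 := hy.2
      rw [hGzero y hy.1 h0, mem_ofPred_eq, dist_comm] at h1
      exact h1.not_gt hc
  set δ := min m 1 / 4 with hδdef
  have hδ : 0 < δ := by positivity
  have hδm : δ ≤ m / 4 := by rw [hδdef]; gcongr; exact min_le_left _ _
  have hδ1 : δ ≤ 1 / 4 := by rw [hδdef]; gcongr; exact min_le_right _ _
  obtain ⟨P, hP, hPG, -⟩ := hG.exists_contDiff_approx 1 (continuous_const (y := δ)) fun _ => hδ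
  obtain ⟨a, ha, hPa⟩ := exists_small_sub_ne_zero hP c hε.ne' hδ
  have hPG' : ∀ y, ‖(P y - a) - G y‖ < 2 * δ := by
    intro y
    have h1 := hPG y
    rw [dist_eq_norm] at h1
    calc ‖(P y - a) - G y‖ = ‖(P y - G y) - a‖ := by congr 1; abel
      _ ≤ ‖P y - G y‖ + ‖a‖ := norm_sub_le _ _
      _ < 2 * δ := by linarith
  let Φ : E → E := fun y => c + max (ε / ‖y - c‖) 1 • (y - c)
  have hne : ∀ y ∈ K, 0 < ‖y - c‖ := fun y hy =>
    norm_pos_iff.2 (sub_ne_zero.2 fun h => hcK (h ▸ hy))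
  have hΦ : ContinuousOn Φ K := by
    refine continuousOn_const.add (ContinuousOn.smul (ContinuousOn.sup ?_ continuousOn_const)
      (by fun_prop))
    exact continuousOn_const.div (by fun_prop) fun y hy => (hne y hy).ne'
  have hΦQ : ∀ y ∈ Q, Φ y = y := by
    intro y hy
    have h1 : ε / ‖y - c‖ ≤ 1 := by
      rw [div_le_one (hne y hy.1), ← dist_eq_norm]; exact hy.2
    simp [Φ, max_eq_right h1]
  have hΦS : ∀ y ∈ K, y ∉ Q → Φ y ∈ Metric.sphere c ε := by
    intro y hy hyQ
    have h0 := hne y hy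
    have h1 : dist y c < ε := by by_contra h; exact hyQ ⟨hy, not_lt.1 h⟩
    rw [dist_eq_norm] at h1
    have h2 : 1 ≤ ε / ‖y - c‖ := by rw [one_le_div h0]; exact h1.le
    rw [mem_sphere_iff_norm, show Φ y - c = (ε / ‖y - c‖) • (y - c) by simp [Φ, max_eq_left h2],
      norm_smul, Real.norm_of_nonneg (by positivity), div_mul_cancel₀ _ h0.ne']
  obtain ⟨y, hy, hy0⟩ := stable (fun y => P (Φ y) - a)
    ((hP.continuous.comp_continuousOn hΦ).sub continuousOn_const) fun y hy => by
      have h1 := hPG' (Φ y)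
      by_cases hyQ : y ∈ Q
      · rw [hΦQ y hyQ] at h1 ⊢
        rw [norm_sub_rev]
        linarith
      · have h2 := Metric.mem_sphere.1 (hΦS y hy hyQ)
        have h3 : dist y c < ε := by by_contra h; exact hyQ ⟨hy, not_lt.1 h⟩
        have h4 := hsmall (Φ y) (by linarith [dist_triangle (Φ y) c (f 0)])
        have h5 := hsmall y (by linarith [dist_triangle y c (f 0)])
        rw [dist_zero_right] at h4 h5
        have h6 : G y - (P (Φ y) - a) = G y - G (Φ y) - ((P (Φ y) - a) - G (Φ y)) := by abel
        rw [h6]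
        linarith [norm_sub_le (G y - G (Φ y)) ((P (Φ y) - a) - G (Φ y)),
          norm_sub_le (G y) (G (Φ y))]
  by_cases hyQ : y ∈ Q
  · rw [hΦQ y hyQ] at hy0
    have h1 := hPG' y
    rw [hy0, zero_sub, norm_neg] at h1
    linarith [hQm y hyQ]
  · exact hPa _ (hΦS y hy hyQ) hy0

/-- **Invariance of domain**. -/
theorem isOpen_image_of_injOn {E : Type*} [NormedAddCommGroup E] [InnerProductSpace ℝ E]
    [FiniteDimensional ℝ E] {f : E → E} {W : Set E} (hW : IsOpen W) (hf : ContinuousOn f W)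
    (hinj : InjOn f W) : IsOpen (f '' W) := by
  rw [isOpen_iff_mem_nhds]
  rintro _ ⟨x, hx, rfl⟩
  obtain ⟨r, hr, hball⟩ := Metric.nhds_basis_closedBall.mem_iff.1 (hW.mem_nhds hx)
  let s : E → E := fun y => x + r • y
  have hs : MapsTo s (Metric.closedBall 0 1) W := by
    intro y hy
    refine hball ?_
    rw [mem_closedBall_zero_iff] at hy
    simp only [s, mem_closedBall_iff_norm, add_sub_cancel_left, norm_smul,
      Real.norm_of_nonneg hr.le]
    nlinarith
  have hsi : Function.Injective s := fun y z h => smul_right_injective E hr.ne'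
    (add_left_cancel h)
  have h := apply_zero_mem_interior_image (f := f ∘ s)
    (hf.comp (by fun_prop) hs) (hinj.comp hsi.injOn hs)
  have h0 : (f ∘ s) 0 = f x := by simp [s]
  rw [h0, mem_interior_iff_mem_nhds] at h
  refine Filter.mem_of_superset h ?_
  rw [image_comp]
  exact image_mono hs.image_subset

/-- A locally constant cocycle with values in `G` on the family of open sets `V a`. -/
structure LocSys (G ι E : Type*) [Group G] [TopologicalSpace E] where
  V : ι → Set E
  isOpen_V : ∀ a, IsOpen (V a)
  g : ι → ι → E → G
  locConst : ∀ a b x, x ∈ V a → x ∈ V b → ∀ᶠ y in nhds x, g a b y = g a b x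
  cocycle : ∀ a b c x, x ∈ V a → x ∈ V b → x ∈ V c → g b c x * g a b x = g a c x

namespace LocSys

variable {G ι E X : Type*} [Group G] [TopologicalSpace E] [TopologicalSpace X]

/-- The open set on which the cocycle lives. -/
def domain (Z : LocSys G ι E) : Set E := ⋃ a, Z.V a

theorem g_self (Z : LocSys G ι E) {a : ι} {x : E} (hx : x ∈ Z.V a) : Z.g a a x = 1 := by
  have := Z.cocycle a a a x hx hx hx
  exact mul_eq_right.1 this

/-- A locally constant trivialization over `S` of the pullback of the cocycle along `h`. -/
structure IsTriv (Z : LocSys G ι E) (S : Set X) (h : X → E) (l : ι → X → G) : Prop where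
  locConst : ∀ a x, x ∈ S → h x ∈ Z.V a → ∀ᶠ y in nhdsWithin x S, l a y = l a x
  g_mul : ∀ a b x, x ∈ S → h x ∈ Z.V a → h x ∈ Z.V b → Z.g a b (h x) * l a x = l b x

theorem IsTriv.mono {Z : LocSys G ι E} {S T : Set X} {h : X → E} {l : ι → X → G}
    (hl : Z.IsTriv S h l) (hTS : T ⊆ S) : Z.IsTriv T h l where
  locConst a x hx ha := (hl.locConst a x (hTS hx) ha).filter_mono (nhdsWithin_mono x hTS)
  g_mul a b x hx := hl.g_mul a b x (hTS hx)

end LocSys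

/-- A cocycle pulled back to a convex open set is trivial. -/
theorem LocSys.exists_isTriv {G ι E X : Type*} [Group G] [TopologicalSpace E]
    [NormedAddCommGroup X] [NormedSpace ℝ X] (Z : LocSys G ι E) {S : Set X} (hS : IsOpen S)
    (hconv : Convex ℝ S) {h : X → E} (hh : ContinuousOn h S) (hdom : MapsTo h S Z.domain) :
    ∃ l, Z.IsTriv S h l := by
  classical
  rcases S.eq_empty_or_nonempty with rfl | hne
  · exact ⟨fun _ _ => 1, by simp, by simp⟩
  let _ : TopologicalSpace G := ⊥
  have _ : DiscreteTopology G := ⟨rfl⟩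
  have hr : Continuous (S.domRestrict h) := hh.domRestrict
  have hex : ∀ x : S, ∃ a, h x ∈ Z.V a := fun x => mem_iUnion.1 (hdom x.2)
  let C : FiberBundleCore ι S G :=
    { baseSet := fun a => {x | h x ∈ Z.V a}
      isOpen_baseSet := fun a => (Z.isOpen_V a).preimage hr
      indexAt := fun x => (hex x).choose
      mem_baseSet_at := fun x => (hex x).choose_spec
      coordChange := fun a b x v => Z.g a b (h x) * v
      coordChange_self := fun a x hx v => by rw [Z.g_self hx, one_mul]
      continuousOn_coordChange := by
        rintro a b ⟨x, v⟩ ⟨hx, -⟩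
        refine ContinuousAt.continuousWithinAt ?_
        rw [ContinuousAt, nhds_prod_eq, nhds_discrete G, Filter.tendsto_pure]
        have h1 : ∀ᶠ y : S in nhds x, Z.g a b (h y) = Z.g a b (h x) :=
          hr.continuousAt.eventually (Z.locConst a b (h x) hx.1 hx.2)
        filter_upwards [h1.prod_mk (Filter.eventually_pure.2 rfl : ∀ᶠ w in pure v, w = v)]
        rintro ⟨y, w⟩ ⟨hy, hw⟩
        simp only at hy hw ⊢
        rw [hy, hw]
      coordChange_comp := fun a b c x hx v => by
        rw [← mul_assoc, Z.cocycle a b c _ hx.1.1 hx.1.2 hx.2] }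
  have hcov : IsCoveringMap (Bundle.TotalSpace.proj (F := G) (E := C.Fiber)) :=
    FiberBundle.isCoveringMap (F := G) (E := C.Fiber)
  have _ : ContractibleSpace S := hconv.contractibleSpace hne
  have _ : LocallyPathConnectedSpace S := hS.locallyPathConnectedSpace
  let x₀ : S := ⟨hne.some, hne.some_mem⟩
  obtain ⟨F, ⟨-, hF⟩, -⟩ := hcov.existsUnique_continuousMap_lifts (ContinuousMap.id S) x₀
    (⟨x₀, (1 : G)⟩ : Bundle.TotalSpace G C.Fiber) rfl
  have hF' : ∀ x, (F x).proj = x := fun x => congrFun hF x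
  let m : ι → S → G := fun a x => (C.localTriv a (F x)).2
  let v : S → G := fun x => (F x).snd
  have hm : ∀ a x, m a x = Z.g (C.indexAt x) a (h x) * v x := by
    intro a x
    have : m a x = Z.g (C.indexAt (F x).proj) a (h (F x).proj) * v x := rfl
    rw [hF' x] at this
    exact this
  have hconst : ∀ a (x : S), h x ∈ Z.V a → ∀ᶠ y in nhds x, m a y = m a x := by
    intro a x hx
    have h2 : ContinuousAt (C.localTriv a) (F x) := by
      refine (C.localTriv a).continuousAt ?_
      rw [FiberBundleCore.mem_localTriv_source]
      change h (F x).proj ∈ Z.V a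
      rwa [hF' x]
    have h3 : ContinuousAt (m a) x :=
      continuous_snd.continuousAt.comp (ContinuousAt.comp h2 F.continuous.continuousAt)
    rwa [ContinuousAt, nhds_discrete G, Filter.tendsto_pure] at h3
  refine ⟨fun a x => if hx : x ∈ S then m a ⟨x, hx⟩ else 1, fun a x hx ha => ?_,
    fun a b x hx ha hb => ?_⟩
  · have h1 := hconst a ⟨x, hx⟩ ha
    rw [nhds_subtype_eq_comap, Filter.eventually_comap] at h1
    filter_upwards [mem_nhdsWithin_of_mem_nhds h1, self_mem_nhdsWithin] with y hy hyS
    rw [dif_pos hx, dif_pos hyS]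
    exact hy ⟨y, hyS⟩ rfl
  · simp only [dif_pos hx, hm]
    rw [← mul_assoc, Z.cocycle _ a b (h x) (C.mem_baseSet_at ⟨x, hx⟩) ha hb]

namespace LocSys

variable {G ι E : Type*} [Group G] [TopologicalSpace E]

/-- Transporting a trivialization forward along an injective open map. -/
theorem IsTriv.exists_image {X Y : Type*} [TopologicalSpace X] [TopologicalSpace Y]
    {Z : LocSys G ι E} {S : Set X} {F : X → Y} {h : Y → E} {l : ι → X → G}
    (hl : Z.IsTriv S (h ∘ F) l) (hinj : InjOn F S)
    (hopen : ∀ W ⊆ S, IsOpen W → IsOpen (F '' W)) (hS : IsOpen S) :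
    ∃ l' : ι → Y → G, Z.IsTriv (F '' S) h l' ∧ ∀ a, ∀ x ∈ S, l' a (F x) = l a x := by
  classical
  rcases isEmpty_or_nonempty X with hX | hX
  · refine ⟨fun _ _ => 1, ⟨?_, ?_⟩, fun a x => (hX.false x).elim⟩
    · rintro a _ ⟨x, -⟩; exact (hX.false x).elim
    · rintro a b _ ⟨x, -⟩; exact (hX.false x).elim
  have hval : ∀ a, ∀ x ∈ S, l a (Function.invFunOn F S (F x)) = l a x := fun a x hx => by
    rw [hinj.leftInvOn_invFunOn hx]
  refine ⟨fun a y => l a (Function.invFunOn F S y), ⟨?_, ?_⟩, hval⟩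
  · rintro a _ ⟨x, hx, rfl⟩ ha
    have h1 := hl.locConst a x hx ha
    rw [hS.nhdsWithin_eq hx] at h1
    obtain ⟨W, hW, hWo, hxW⟩ := mem_nhds_iff.1 (Filter.inter_mem h1 (hS.mem_nhds hx))
    have h2 : F '' W ∈ nhds (F x) :=
      (hopen W (fun y hy => (hW hy).2) hWo).mem_nhds (mem_image_of_mem F hxW)
    filter_upwards [mem_nhdsWithin_of_mem_nhds h2]
    rintro _ ⟨y, hy, rfl⟩
    simp only [hval a y (hW hy).2, hval a x hx]
    exact (hW hy).1
  · rintro a b _ ⟨x, hx, rfl⟩ ha hb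
    simp only [hval a x hx, hval b x hx]
    exact hl.g_mul a b x hx ha hb

/-- Two trivializations over connected sets differ by a constant on the overlap. -/
theorem IsTriv.exists_eq_inv_mul {X : Type*} [TopologicalSpace X] {Z : LocSys G ι E}
    {S T : Set X} {h : X → E} {l m : ι → X → G} (hl : Z.IsTriv S h l) (hm : Z.IsTriv T h m)
    (hc : IsPreconnected (S ∩ T)) (hh : ContinuousOn h (S ∩ T))
    (hdom : MapsTo h (S ∩ T) Z.domain) :
    ∃ s : G, ∀ x ∈ S ∩ T, ∀ a, h x ∈ Z.V a → (m a x)⁻¹ * l a x = s := by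
  classical
  rcases (S ∩ T).eq_empty_or_nonempty with he | ⟨x₀, hx₀⟩
  · exact ⟨1, fun x hx => by rw [he] at hx; exact hx.elim⟩
  have hex : ∀ x : X, ∃ a, x ∈ S ∩ T → h x ∈ Z.V a := fun x => by
    by_cases hx : x ∈ S ∩ T
    · obtain ⟨a, ha⟩ := mem_iUnion.1 (hdom hx)
      exact ⟨a, fun _ => ha⟩
    · obtain ⟨a, -⟩ := mem_iUnion.1 (hdom hx₀)
      exact ⟨a, fun h => (hx h).elim⟩
  choose c hcV using hex
  have key : ∀ x ∈ S ∩ T, ∀ a b, h x ∈ Z.V a → h x ∈ Z.V b →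
      (m a x)⁻¹ * l a x = (m b x)⁻¹ * l b x := by
    intro x hx a b ha hb
    rw [← hl.g_mul a b x hx.1 ha hb, ← hm.g_mul a b x hx.2 ha hb]
    group
  let _ : TopologicalSpace G := ⊥
  have _ : DiscreteTopology G := ⟨rfl⟩
  let φ : X → G := fun x => (m (c x) x)⁻¹ * l (c x) x
  have hφ : ContinuousOn φ (S ∩ T) := by
    intro x hx
    rw [ContinuousWithinAt, nhds_discrete G, Filter.tendsto_pure]
    filter_upwards [(hl.locConst (c x) x hx.1 (hcV x hx)).filter_mono
      (nhdsWithin_mono x inter_subset_left), (hm.locConst (c x) x hx.2 (hcV x hx)).filter_mono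
      (nhdsWithin_mono x inter_subset_right), self_mem_nhdsWithin,
      hh x hx ((Z.isOpen_V (c x)).mem_nhds (hcV x hx))] with y h1 h2 hy h3
    rw [show φ y = (m (c x) y)⁻¹ * l (c x) y from key y hy _ _ (hcV y hy) h3, h1, h2]
  exact ⟨φ x₀, fun x hx a ha =>
    (key x hx a (c x) ha (hcV x hx)).trans (hc.constant hφ hx hx₀)⟩

/-- Gluing the pullback of the cocycle along `hi` over `O₁` to a trivial cocycle over `O₂`. -/
theorem exists_isTriv_of_glue {X κ : Type*} [NormedAddCommGroup X] [NormedSpace ℝ X]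
    (Z : LocSys G ι E) {B O₁ O₂ : Set X} (hB : IsOpen B) (hconv : Convex ℝ B)
    (hO₁ : IsOpen O₁) (hO₂ : IsOpen O₂) (hO₁B : O₁ ⊆ B) (hcov : B ⊆ O₁ ∪ O₂)
    {hi hj : X → E} (hhi : Continuous hi) (hhj : Continuous hj) (hidom : MapsTo hi O₁ Z.domain)
    (hjdom : MapsTo hj B Z.domain) {T : κ → Set X} (hT : ∀ a, IsOpen (T a))
    (hTcov : O₁ ∩ O₂ ⊆ ⋃ a, T a) {li lj : κ → ι → X → G}
    (hli : ∀ a, Z.IsTriv (T a) hi (li a)) (hlj : ∀ a, Z.IsTriv (T a) hj (lj a))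
    (hσ : ∀ a b, ∀ y ∈ T a ∩ T b, ∀ α β, hi y ∈ Z.V α → hj y ∈ Z.V β →
      (li b α y)⁻¹ * li a α y = (lj b β y)⁻¹ * lj a β y) :
    ∃ l, Z.IsTriv O₁ hi l := by
  classical
  obtain ⟨μ, hμ⟩ := Z.exists_isTriv hB hconv hhj.continuousOn hjdom
  have hTeq : ∀ {a y}, y ∈ T a → nhdsWithin y (T a) = nhds y := fun h => (hT _).nhdsWithin_eq h
  have hex : ∀ y ∈ O₁ ∩ O₂, ∃ p : κ × ι, y ∈ T p.1 ∧ hj y ∈ Z.V p.2 := by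
    intro y hy
    obtain ⟨a, ha⟩ := mem_iUnion.1 (hTcov hy)
    obtain ⟨β, hβ⟩ := mem_iUnion.1 (hjdom (hO₁B hy.1))
    exact ⟨(a, β), ha, hβ⟩
  let τ : ι → X → G := fun α y => if hy : y ∈ O₁ ∩ O₂ then
    li (hex y hy).choose.1 α y * (lj (hex y hy).choose.1 (hex y hy).choose.2 y)⁻¹ *
      μ (hex y hy).choose.2 y else 1
  have key : ∀ y ∈ O₁ ∩ O₂, ∀ α, hi y ∈ Z.V α → ∀ a β, y ∈ T a → hj y ∈ Z.V β →
      τ α y = li a α y * (lj a β y)⁻¹ * μ β y := by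
    intro y hy α hα a β ha hβ
    simp only [τ, dif_pos hy]
    generalize hp : (hex y hy).choose = p
    obtain ⟨hb, hγ⟩ : y ∈ T p.1 ∧ hj y ∈ Z.V p.2 := hp ▸ (hex y hy).choose_spec
    rw [← (hlj a).g_mul p.2 β y ha hγ hβ, ← hμ.g_mul p.2 β y (hO₁B hy.1) hγ hβ]
    have h1 := hσ a p.1 y ⟨ha, hb⟩ α p.2 hα hγ
    have h2 : li a α y = li p.1 α y * ((lj p.1 p.2 y)⁻¹ * lj a p.2 y) := by
      rw [← h1]; group
    rw [h2]; group
  have τconst : ∀ α y, y ∈ O₁ ∩ O₂ → hi y ∈ Z.V α → ∀ᶠ z in nhds y, τ α z = τ α y := by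
    intro α y hy hα
    obtain ⟨⟨a, β⟩, ha, hβ⟩ := hex y hy
    have h1 := (hli a).locConst α y ha hα
    have h2 := (hlj a).locConst β y ha hβ
    have h3 := hμ.locConst β y (hO₁B hy.1) hβ
    rw [hTeq ha] at h1 h2
    rw [hB.nhdsWithin_eq (hO₁B hy.1)] at h3
    filter_upwards [h1, h2, h3, (hO₁.inter hO₂).mem_nhds hy, (hT a).mem_nhds ha,
      hhi.continuousAt ((Z.isOpen_V α).mem_nhds hα),
      hhj.continuousAt ((Z.isOpen_V β).mem_nhds hβ)] with z e1 e2 e3 hz hza hzα hzβ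
    rw [key z hz α hzα a β hza hzβ, key y hy α hα a β ha hβ, e1, e2, e3]
  have τmul : ∀ α β y, y ∈ O₁ ∩ O₂ → hi y ∈ Z.V α → hi y ∈ Z.V β →
      Z.g α β (hi y) * τ α y = τ β y := by
    intro α β y hy hα hβ
    obtain ⟨⟨a, γ⟩, ha, hγ⟩ := hex y hy
    rw [key y hy α hα a γ ha hγ, key y hy β hβ a γ ha hγ, ← (hli a).g_mul α β y ha hα hβ]
    simp only [mul_assoc]
  let Y : LocSys G (Option ι) X :=
    { V := fun o => o.elim O₂ fun α => O₁ ∩ hi ⁻¹' Z.V α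
      isOpen_V := by
        rintro (_ | α)
        · exact hO₂
        · exact hO₁.inter ((Z.isOpen_V α).preimage hhi)
      g := fun o o' y => o.elim (o'.elim 1 fun β => τ β y)
        fun α => o'.elim (τ α y)⁻¹ fun β => Z.g α β (hi y)
      locConst := by
        rintro (_ | α) (_ | β) y ha hb
        · exact Filter.Eventually.of_forall fun _ => rfl
        · exact τconst β y ⟨hb.1, ha⟩ hb.2
        · filter_upwards [τconst α y ⟨ha.1, hb⟩ ha.2] with z hz
          exact congrArg Inv.inv hz
        · exact hhi.continuousAt.eventually (Z.locConst α β _ ha.2 hb.2)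
      cocycle := by
        rintro (_ | α) (_ | β) (_ | γ) y ha hb hc
        · exact one_mul _
        · exact mul_one _
        · exact inv_mul_cancel _
        · exact τmul β γ y ⟨hb.1, ha⟩ hb.2 hc.2
        · exact one_mul _
        · change τ γ y * (τ α y)⁻¹ = Z.g α γ (hi y)
          rw [← τmul α γ y ⟨ha.1, hb⟩ ha.2 hc.2, mul_inv_cancel_right]
        · change (τ β y)⁻¹ * Z.g α β (hi y) = (τ α y)⁻¹
          rw [← τmul α β y ⟨ha.1, hc⟩ ha.2 hb.2]; group
        · exact Z.cocycle α β γ _ ha.2 hb.2 hc.2 }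
  obtain ⟨l, hl⟩ := Y.exists_isTriv hB hconv (h := id) continuousOn_id fun y hy => by
    rcases hcov hy with h | h
    · obtain ⟨α, hα⟩ := mem_iUnion.1 (hidom h)
      exact mem_iUnion.2 ⟨some α, h, hα⟩
    · exact mem_iUnion.2 ⟨none, h⟩
  refine ⟨fun α => l (some α), fun α y hy hα => ?_, fun α β y hy hα hβ => ?_⟩
  · exact (hl.locConst (some α) y (hO₁B hy) ⟨hy, hα⟩).filter_mono (nhdsWithin_mono y hO₁B)
  · exact hl.g_mul (some α) (some β) y (hO₁B hy) ⟨hy, hα⟩ ⟨hy, hβ⟩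

end LocSys

/-- The iterates of a discrete dynamical system with attractor `A`, as partially defined maps of
the ambient space. -/
theorem IsAttractor.exists_iterates {U A : Set R3} {f : U → U} (hf : Continuous f)
    (hinj : Function.Injective f) (h : IsAttractor f A) :
    ∃ F : ℕ → R3 → R3, (∀ n, ContinuousOn (F n) U) ∧ (∀ n, InjOn (F n) U) ∧
      (∀ n, F n '' A = A) ∧ ∃ N₀ ⊆ U, A ⊆ interior N₀ ∧ ∀ P ⊆ N₀, IsCompact P →
        ∀ V, IsOpen V → A ⊆ V → ∃ n, F n '' P ⊆ V := by
  classical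
  obtain ⟨-, hAU, hinv, N₀, hN₀U, hAN₀, hatt⟩ := h
  let F₁ : R3 → R3 := fun x => if hx : x ∈ U then (f ⟨x, hx⟩ : R3) else x
  have hF₁ : ∀ n (x : U), F₁^[n] x = f^[n] x := by
    intro n x
    induction n with
    | zero => rfl
    | succ n ih =>
      rw [Function.iterate_succ_apply', Function.iterate_succ_apply', ih]
      simp [F₁]
  have hr : ∀ n, U.domRestrict F₁^[n] = Subtype.val ∘ f^[n] := fun n => funext fun x => hF₁ n x
  have himg : ∀ n, ∀ P ⊆ U, F₁^[n] '' P = imgIter f n P := by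
    intro n P hP
    ext y
    constructor
    · rintro ⟨x, hx, rfl⟩
      exact ⟨f^[n] ⟨x, hP hx⟩, ⟨⟨x, hP hx⟩, hx, rfl⟩, (hF₁ n ⟨x, hP hx⟩).symm⟩
    · rintro ⟨_, ⟨x, hx, rfl⟩, rfl⟩
      exact ⟨x, hx, hF₁ n x⟩
  have h1 : F₁ '' A = A := (himg 1 A hAU).trans hinv
  refine ⟨fun n => F₁^[n], fun n => ?_, fun n => ?_, fun n => ?_, N₀, hN₀U, hAN₀,
    fun P hPN hP V hV hAV => ?_⟩
  · rw [continuousOn_iff_continuous_domRestrict, hr]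
    exact continuous_subtype_val.comp (hf.iterate n)
  · rw [injOn_iff_injective, hr]
    exact Subtype.val_injective.comp (hinj.iterate n)
  · induction n with
    | zero => simp
    | succ n ih =>
      change F₁^[n] '' A = A at ih
      change F₁^[n + 1] '' A = A
      rw [Function.iterate_succ', image_comp, ih, h1]
  · obtain ⟨n, hn⟩ := hatt P hP hPN V (hAV.trans hV.interior_eq.ge)
    exact ⟨n, (himg n P (hPN.trans hN₀U)).trans_subset (hn n le_rfl)⟩

/-- A finite group valued cocycle obstruction to being an attractor. -/
theorem not_isAttractor_of_locSys {G ι : Type*} [Group G] [Finite G] {Z : LocSys G ι R3}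
    {A : Set R3} (hA : IsCompact A) {h : ℕ → R3 → R3} {B Γ : ℕ → Set R3}
    (hh : ∀ i, Continuous (h i)) (hdom : ∀ i, MapsTo (h i) Aᶜ Z.domain)
    (hB : ∀ i, IsOpen (B i)) (hconv : ∀ i, Convex ℝ (B i))
    (hBdom : ∀ i j, i ≠ j → MapsTo (h j) (B i) Z.domain) (hΓ : ∀ i, IsCompact (Γ i))
    (hΓB : ∀ i, Γ i ⊆ B i) (hΓA : ∀ i, Disjoint (Γ i) A)
    (hnt : ∀ i l, ¬ Z.IsTriv (Γ i) (h i) l)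
    {U : Set R3} (hU : IsOpen U) {f : U → U} (hf : Continuous f) (hinj : Function.Injective f) :
    ¬ IsAttractor f A := by
  classical
  intro hatt
  have hAU : A ⊆ U := hatt.2.1
  obtain ⟨F, hFc, hFi, hFA, N₀, hN₀U, hAN₀, hF⟩ := hatt.exists_iterates hf hinj
  obtain ⟨N, hN, hAN, hNN₀⟩ := exists_compact_between hA isOpen_interior hAN₀
  obtain ⟨N₁, hN₁, hAN₁, hN₁N⟩ := exists_compact_between hA isOpen_interior hAN
  have hNU : N ⊆ U := hNN₀.trans (interior_subset.trans hN₀U)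
  have hL : IsCompact (N \ interior N₁) := hN.diff isOpen_interior
  have hUA : IsOpen (U \ A) := hU.sdiff hA.isClosed
  have hball : ∀ x ∈ N \ interior N₁, ∃ r > 0, Metric.ball x r ⊆ U \ A := fun x hx =>
    Metric.isOpen_iff.1 hUA x ⟨hNU hx.1, fun h => hx.2 (hAN₁ h)⟩
  choose! r hr0 hrU using hball
  obtain ⟨t, htL, ht⟩ := hL.elim_nhds_subcover (fun x => Metric.ball x (r x))
    fun x hx => Metric.ball_mem_nhds x (hr0 x hx)
  let S : t → Set R3 := fun a => Metric.ball a (r a)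
  have hSU : ∀ a, S a ⊆ U \ A := fun a => hrU a (htL a a.2)
  let _ := Fintype.ofFinite G
  let M := Fintype.card (t → t → G)
  obtain ⟨n, hn⟩ := hF N (hNN₀.trans interior_subset) hN
    (⋂ i : Fin (M + 1), (Γ i)ᶜ) (isOpen_iInter_of_finite fun i => (hΓ i).isClosed.isOpen_compl)
    (subset_iInter fun i => (hΓA i).subset_compl_left)
  have hFA' : ∀ x ∈ U, x ∉ A → F n x ∉ A := by
    intro x hx hxA h1
    rw [← hFA n] at h1
    obtain ⟨y, hy, hyx⟩ := h1
    exact hxA (hFi n (hAU hy) hx hyx ▸ hy)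
  have hFS : ∀ a, ContinuousOn (F n) (S a) := fun a => (hFc n).mono fun x hx => (hSU a hx).1
  have hSdom : ∀ i a, MapsTo (h i ∘ F n) (S a) Z.domain := fun i a x hx =>
    hdom i (hFA' x (hSU a hx).1 (hSU a hx).2)
  have htriv : ∀ i a, ∃ l, Z.IsTriv (S a) (h i ∘ F n) l := fun i a =>
    Z.exists_isTriv Metric.isOpen_ball (convex_ball _ _)
      ((hh i).comp_continuousOn (hFS a)) (hSdom i a)
  choose l hl using htriv
  have hσ : ∀ i a b, ∃ s, ∀ x ∈ S a ∩ S b, ∀ α, (h i ∘ F n) x ∈ Z.V α →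
      (l i b α x)⁻¹ * l i a α x = s := fun i a b =>
    (hl i a).exists_eq_inv_mul (hl i b)
      ((convex_ball _ _).inter (convex_ball _ _)).isPreconnected
      ((hh i).comp_continuousOn ((hFS a).mono inter_subset_left))
      ((hSdom i a).mono_left inter_subset_left)
  choose σ hσ using hσ
  obtain ⟨i, j, hij, hσij⟩ := Fintype.exists_ne_map_eq_of_card_lt
    (fun i : Fin (M + 1) => σ i) (by simp [M])
  have hij' : (i : ℕ) ≠ j := fun h => hij (Fin.ext h)
  have hopen : ∀ W ⊆ U, IsOpen W → IsOpen (F n '' W) := fun W hW hWo =>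
    isOpen_image_of_injOn hWo ((hFc n).mono hW) ((hFi n).mono hW)
  have hSU' : ∀ a, S a ⊆ U := fun a x hx => (hSU a hx).1
  have himage : ∀ (i : ℕ) a, ∃ l' : ι → R3 → G, Z.IsTriv (F n '' S a) (h i) l' ∧
      ∀ α, ∀ x ∈ S a, l' α (F n x) = l i a α x := fun i a =>
    (hl i a).exists_image ((hFi n).mono (hSU' a))
      (fun W hW => hopen W (hW.trans (hSU' a))) Metric.isOpen_ball
  choose l' hl' hll' using himage
  have hN₁U : N₁ ⊆ U := (hN₁N.trans interior_subset).trans hNU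
  have hAF : A ⊆ F n '' N₁ := (hFA n).symm.subset.trans
    (image_mono (hAN₁.trans interior_subset))
  obtain ⟨m, hm⟩ := Z.exists_isTriv_of_glue (B := B i) (O₁ := B i \ F n '' N₁)
    (O₂ := B i ∩ F n '' interior N) (hi := h i) (hj := h j) (hB i) (hconv i)
    ((hB i).sdiff (hN₁.image_of_continuousOn ((hFc n).mono hN₁U)).isClosed)
    ((hB i).inter (hopen _ (interior_subset.trans hNU) isOpen_interior)) sdiff_subset
    (fun y hy => by
      by_cases hyN : y ∈ F n '' N₁
      · exact Or.inr ⟨hy, image_mono hN₁N hyN⟩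
      · exact Or.inl ⟨hy, hyN⟩)
    (hh i) (hh j) (fun y hy => hdom i fun h => hy.2 (hAF h)) (hBdom i j hij')
    (T := fun a => F n '' S a) (fun a => hopen _ (hSU' a) Metric.isOpen_ball)
    (by
      rintro y ⟨⟨-, hy⟩, -, x, hx, rfl⟩
      have hxL : x ∈ N \ interior N₁ :=
        ⟨interior_subset hx, fun h => hy ⟨x, interior_subset h, rfl⟩⟩
      obtain ⟨a, ha, hxa⟩ := mem_iUnion₂.1 (ht hxL)
      exact mem_iUnion.2 ⟨⟨a, ha⟩, x, hxa, rfl⟩)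
    (hl' i) (hl' j) (by
      rintro a b _ ⟨⟨x, hx, rfl⟩, x', hx', hxx⟩ α β hα hβ
      obtain rfl := hFi n (hSU' b hx') (hSU' a hx) hxx
      rw [hll' i b α x' hx', hll' i a α x' hx, hll' j b β x' hx', hll' j a β x' hx,
        hσ i a b x' ⟨hx, hx'⟩ α hα, hσ j a b x' ⟨hx, hx'⟩ β hβ]
      exact congrFun (congrFun hσij a) b)
  refine hnt i m (hm.mono fun y hy => ⟨hΓB i hy, fun hyN => ?_⟩)
  exact mem_iInter.1 (hn (image_mono (hN₁N.trans interior_subset) hyN)) i hy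

/-- The first basis vector. -/
def axis : R3 := EuclideanSpace.single 0 1

@[simp] theorem axis_zero : axis 0 = 1 := by simp [axis]

@[simp] theorem norm_axis : ‖axis‖ = 1 := by simp [axis]

/-- The embedding of `ℝ³` onto the slab `|w 0| < 1` that scales the plane with first
coordinate `t` by the factor `(1 + |t|)⁻¹`. -/
def pinch (w : R3) : R3 := (1 + |w 0|)⁻¹ • w

/-- The inverse of `pinch` on the slab `|w 0| < 1`. -/
def unpinch (w : R3) : R3 := (1 - |w 0|)⁻¹ • w

theorem pinch_zero_apply (w : R3) : pinch w 0 = (1 + |w 0|)⁻¹ * w 0 := rfl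

theorem unpinch_zero_apply (w : R3) : unpinch w 0 = (1 - |w 0|)⁻¹ * w 0 := rfl

theorem one_sub_abs_pinch (w : R3) : 1 - |pinch w 0| = (1 + |w 0|)⁻¹ := by
  have h : 0 < 1 + |w 0| := by positivity
  rw [pinch_zero_apply, abs_mul, abs_of_pos (inv_pos.2 h)]
  field_simp
  ring

theorem abs_pinch_lt (w : R3) : |pinch w 0| < 1 := by
  have h : 0 < (1 + |w 0|)⁻¹ := by positivity
  linarith [one_sub_abs_pinch w]

theorem unpinch_pinch (w : R3) : unpinch (pinch w) = w := by
  have h : 1 + |w 0| ≠ 0 := by positivity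
  rw [unpinch, one_sub_abs_pinch, pinch, smul_smul, inv_inv, mul_inv_cancel₀ h, one_smul]

theorem pinch_unpinch {w : R3} (hw : |w 0| < 1) : pinch (unpinch w) = w := by
  have h : 0 < 1 - |w 0| := by linarith
  have h1 : 1 + |unpinch w 0| = (1 - |w 0|)⁻¹ := by
    rw [unpinch_zero_apply, abs_mul, abs_of_pos (inv_pos.2 h)]
    field_simp
    ring
  rw [pinch, h1, unpinch, smul_smul, inv_inv, mul_inv_cancel₀ h.ne', one_smul]

theorem pinch_injective : Function.Injective pinch :=
  Function.LeftInverse.injective unpinch_pinch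

theorem continuous_pinch : Continuous pinch := by
  have h : Continuous fun w : R3 => 1 + |w 0| := by fun_prop
  exact (h.inv₀ fun w => by positivity).smul continuous_id

theorem continuousOn_unpinch : ContinuousOn unpinch {w | |w 0| < 1} := by
  have h : Continuous fun w : R3 => 1 - |w 0| := by fun_prop
  exact (h.continuousOn.inv₀ fun w hw => (sub_pos.2 hw).ne').smul continuousOn_id

theorem pinch_smul_axis (t : ℝ) : pinch (t • axis) = ((1 + |t|)⁻¹ * t) • axis := by
  simp [pinch, smul_smul]

theorem norm_pinch_sub_pinch_le {x : R3} {t K : ℝ} (hx : ‖x - t • axis‖ ≤ K) :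
    ‖pinch x - pinch (t • axis)‖ ≤ K * (2 * K + 2) * (1 + |t|)⁻¹ := by
  have hK : 0 ≤ K := (norm_nonneg _).trans hx
  have ht : 0 < 1 + |t| := by positivity
  have hx0 : 0 < 1 + |x 0| := by positivity
  have h0 : |x 0 - t| ≤ K := by
    have := PiLp.norm_apply_le (x - t • axis) 0
    simp at this
    exact this.trans hx
  have h1 : pinch x - pinch (t • axis) = (1 + |t|)⁻¹ • (x - t • axis) +
      ((|t| - |x 0|) * (1 + |t|)⁻¹ * (1 + |x 0|)⁻¹) • x := by
    have e : (1 + |x 0|)⁻¹ = (1 + |t|)⁻¹ + (|t| - |x 0|) * (1 + |t|)⁻¹ * (1 + |x 0|)⁻¹ := by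
      field_simp
      ring
    rw [pinch_smul_axis, pinch]
    nth_rewrite 1 [e]
    rw [add_smul, smul_sub, smul_smul]
    abel
  have h2 : ‖x‖ ≤ (2 * K + 1) * (1 + |x 0|) := by
    have h3 : ‖x‖ ≤ K + |t| := by
      calc ‖x‖ = ‖(x - t • axis) + t • axis‖ := by rw [sub_add_cancel]
        _ ≤ ‖x - t • axis‖ + ‖t • axis‖ := norm_add_le _ _
        _ ≤ K + |t| := by rw [norm_smul, norm_axis]; simpa using hx
    have h4 : |t| ≤ K + |x 0| := by
      have := abs_sub_abs_le_abs_sub t (x 0)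
      rw [abs_sub_comm] at this
      linarith
    nlinarith [mul_nonneg hK (abs_nonneg (x 0)), abs_nonneg (x 0)]
  have h5 : |(|t| - |x 0|)| ≤ K := (abs_abs_sub_abs_le t (x 0)).trans (by rwa [abs_sub_comm])
  have h6 : (1 + |x 0|)⁻¹ * ‖x‖ ≤ 2 * K + 1 := by
    rw [inv_mul_le_iff₀ hx0]
    linarith
  rw [h1]
  calc _ ≤ ‖(1 + |t|)⁻¹ • (x - t • axis)‖ +
      ‖((|t| - |x 0|) * (1 + |t|)⁻¹ * (1 + |x 0|)⁻¹) • x‖ := norm_add_le _ _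
    _ = (1 + |t|)⁻¹ * ‖x - t • axis‖ +
      |(|t| - |x 0|)| * (1 + |t|)⁻¹ * ((1 + |x 0|)⁻¹ * ‖x‖) := by
        simp only [norm_smul, Real.norm_eq_abs, abs_mul, abs_of_pos (inv_pos.2 ht),
          abs_of_pos (inv_pos.2 hx0)]
        ring
    _ ≤ (1 + |t|)⁻¹ * K + K * (1 + |t|)⁻¹ * (2 * K + 1) := by gcongr
    _ = _ := by ring

/-- The arc obtained by pinching both ends of an unbounded curve. -/
def pinchArc (c : ℝ → R3) (u : ℝ) : R3 :=
  if |u| < 1 then pinch (c ((1 - |u|)⁻¹ * u)) else u • axis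

theorem pinchArc_of_lt (c : ℝ → R3) {u : ℝ} (hu : |u| < 1) :
    pinchArc c u = pinch (c ((1 - |u|)⁻¹ * u)) := if_pos hu

theorem pinchArc_of_le (c : ℝ → R3) {u : ℝ} (hu : 1 ≤ |u|) : pinchArc c u = u • axis :=
  if_neg hu.not_gt

theorem one_add_abs_inv_mul {u : ℝ} (hu : |u| < 1) :
    1 + |(1 - |u|)⁻¹ * u| = (1 - |u|)⁻¹ := by
  have h : 0 < 1 - |u| := by linarith
  rw [abs_mul, abs_of_pos (inv_pos.2 h)]
  field_simp
  ring

theorem inv_mul_inv_mul {u : ℝ} (hu : |u| < 1) :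
    (1 + |(1 - |u|)⁻¹ * u|)⁻¹ * ((1 - |u|)⁻¹ * u) = u := by
  have h : 1 - |u| ≠ 0 := by linarith
  rw [one_add_abs_inv_mul hu, inv_inv, mul_inv_cancel_left₀ h]

theorem pinchArc_inv_mul (c : ℝ → R3) (t : ℝ) : pinchArc c ((1 + |t|)⁻¹ * t) = pinch (c t) := by
  have h : |(1 + |t|)⁻¹ * t| < 1 := by simpa [pinch_zero_apply] using abs_pinch_lt (t • axis)
  have e : 1 - |(1 + |t|)⁻¹ * t| = (1 + |t|)⁻¹ := by
    simpa [pinch_zero_apply] using one_sub_abs_pinch (t • axis)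
  have h0 : 1 + |t| ≠ 0 := by positivity
  rw [pinchArc_of_lt c h, e, inv_inv, mul_inv_cancel_left₀ h0]

theorem abs_pinchArc_lt (c : ℝ → R3) {u : ℝ} (hu : |u| < 1) : |pinchArc c u 0| < 1 := by
  rw [pinchArc_of_lt c hu]
  exact abs_pinch_lt _

theorem abs_pinchArc_le (c : ℝ → R3) {u : ℝ} (hu : |u| ≤ 1) : |pinchArc c u 0| ≤ 1 := by
  rcases hu.lt_or_eq with h | h
  · exact (abs_pinchArc_lt c h).le
  · rw [pinchArc_of_le c h.ge]
    simpa using hu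

theorem norm_pinchArc_sub_le {c : ℝ → R3} {K : ℝ} (hK : ∀ u, ‖c u - u • axis‖ ≤ K) (u : ℝ) :
    ‖pinchArc c u - u • axis‖ ≤ K * (2 * K + 2) * max (1 - |u|) 0 := by
  rcases lt_or_ge |u| 1 with hu | hu
  · have h := norm_pinch_sub_pinch_le (hK ((1 - |u|)⁻¹ * u))
    rw [pinch_smul_axis, inv_mul_inv_mul hu, one_add_abs_inv_mul hu, inv_inv] at h
    rwa [pinchArc_of_lt c hu, max_eq_left (by linarith)]
  · rw [pinchArc_of_le c hu, max_eq_right (by linarith)]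
    simp

theorem continuous_pinchArc {c : ℝ → R3} (hc : Continuous c) {K : ℝ}
    (hK : ∀ u, ‖c u - u • axis‖ ≤ K) : Continuous (pinchArc c) := by
  rw [continuous_iff_continuousAt]
  intro u
  rcases lt_or_ge |u| 1 with hu | hu
  · have hev : ∀ᶠ v in nhds u, |v| < 1 := continuous_abs.continuousAt.eventually_lt_const hu
    have h1 : ContinuousAt (fun v : ℝ => pinch (c ((1 - |v|)⁻¹ * v))) u := by
      refine (continuous_pinch.comp hc).continuousAt.comp ?_
      refine ContinuousAt.mul (ContinuousAt.inv₀ (by fun_prop) ?_) continuousAt_id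
      exact (sub_pos.2 hu).ne'
    refine h1.congr ?_
    filter_upwards [hev] with v hv
    rw [pinchArc_of_lt c hv]
  · have h1 : Filter.Tendsto (fun v => pinchArc c v - v • axis) (nhds u) (nhds 0) := by
      refine squeeze_zero_norm (norm_pinchArc_sub_le hK) ?_
      have h2 : Continuous fun v : ℝ => K * (2 * K + 2) * max (1 - |v|) 0 := by fun_prop
      have h3 := h2.tendsto u
      rwa [max_eq_right (by linarith), mul_zero] at h3
    have h4 : Filter.Tendsto (fun v : ℝ => v • axis) (nhds u) (nhds (u • axis)) :=
      Continuous.tendsto (by fun_prop) u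
    have h5 := h1.add h4
    rw [zero_add] at h5
    rw [ContinuousAt, pinchArc_of_le c hu]
    simpa using h5

theorem pinchArc_injective {c : ℝ → R3} (hc : Function.Injective c) :
    Function.Injective (pinchArc c) := by
  have key : ∀ u v, |u| < 1 → pinchArc c u = pinchArc c v → |v| < 1 := by
    intro u v hu h
    by_contra! hv
    have := abs_pinchArc_lt c hu
    rw [h, pinchArc_of_le c hv] at this
    simp at this
    linarith
  intro u v h
  by_cases hu : |u| < 1
  · have hv := key u v hu h
    rw [pinchArc_of_lt c hu, pinchArc_of_lt c hv] at h
    have h1 := hc (pinch_injective h)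
    rw [← inv_mul_inv_mul hu, h1, inv_mul_inv_mul hv]
  · have hv : ¬ |v| < 1 := fun hv => hu (key v u hv h.symm)
    rw [pinchArc_of_le c (not_lt.1 hu), pinchArc_of_le c (not_lt.1 hv)] at h
    simpa using congrArg (fun w : R3 => w 0) h

/-- The concatenation of the translates of `pinchArc c` by even multiples of `axis`. -/
def periodicArc (c : ℝ → R3) (u : ℝ) : R3 :=
  u • axis + (pinchArc c (2 * Int.fract ((u + 1) / 2) - 1) -
    (2 * Int.fract ((u + 1) / 2) - 1) • axis)

theorem periodicArc_add (c : ℝ → R3) (k : ℤ) {r : ℝ} (hr : |r| ≤ 1) :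
    periodicArc c (r + 2 * k) = pinchArc c r + (2 * k : ℝ) • axis := by
  obtain ⟨h1, h2⟩ := abs_le.1 hr
  rcases h2.lt_or_eq with h2 | rfl
  · have e : 2 * Int.fract ((r + 2 * k + 1) / 2) - 1 = r := by
      rw [show (r + 2 * k + 1) / 2 = (r + 1) / 2 + k by ring, Int.fract_add_intCast,
        Int.fract_eq_self.2 ⟨by linarith, by linarith⟩]
      ring
    rw [periodicArc, e, add_smul]
    abel
  · have e : Int.fract (((1 : ℝ) + 2 * k + 1) / 2) = 0 := by
      rw [show ((1 : ℝ) + 2 * k + 1) / 2 = ((k + 1 : ℤ) : ℝ) by push_cast; ring,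
        Int.fract_intCast]
    rw [periodicArc, e, pinchArc_of_le c (by norm_num), pinchArc_of_le c (by norm_num), add_smul]
    module

theorem exists_eq_add_two_mul (u : ℝ) : ∃ (k : ℤ) (r : ℝ), -1 ≤ r ∧ r < 1 ∧ u = r + 2 * k :=
  ⟨⌊(u + 1) / 2⌋, u - 2 * ⌊(u + 1) / 2⌋, by linarith [Int.floor_le ((u + 1) / 2)],
    by linarith [Int.lt_floor_add_one ((u + 1) / 2)], by ring⟩

theorem continuous_periodicArc {c : ℝ → R3} (hc : Continuous c) {K : ℝ}
    (hK : ∀ u, ‖c u - u • axis‖ ≤ K) : Continuous (periodicArc c) := by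
  have hp := continuous_pinchArc hc hK
  have h1 : Continuous ((fun r => pinchArc c (2 * r - 1) - (2 * r - 1) • axis) ∘
      (Int.fract : ℝ → ℝ)) := by
    refine ContinuousOn.comp_fract'' (Continuous.continuousOn (by fun_prop)) ?_
    rw [pinchArc_of_le c (by norm_num), pinchArc_of_le c (by norm_num)]
    simp
  have h2 : Continuous fun u : ℝ => (u + 1) / 2 := by fun_prop
  exact (continuous_id.smul continuous_const).add (h1.comp h2)

theorem periodicArc_injective {c : ℝ → R3} (hc : Function.Injective c) :
    Function.Injective (periodicArc c) := by
  have hlt : ∀ r : ℝ, -1 ≤ r → r < 1 → -1 ≤ pinchArc c r 0 ∧ pinchArc c r 0 < 1 := by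
    intro r h1 h2
    rcases h1.lt_or_eq with h | rfl
    · have := abs_lt.1 (abs_pinchArc_lt c (abs_lt.2 ⟨h, h2⟩))
      exact ⟨this.1.le, this.2⟩
    · rw [pinchArc_of_le c (by norm_num)]
      simp
  intro u v h
  obtain ⟨k, r, hr1, hr2, rfl⟩ := exists_eq_add_two_mul u
  obtain ⟨m, s, hs1, hs2, rfl⟩ := exists_eq_add_two_mul v
  rw [periodicArc_add c k (abs_le.2 ⟨hr1, hr2.le⟩),
    periodicArc_add c m (abs_le.2 ⟨hs1, hs2.le⟩)] at h
  have h0 := congrArg (fun w : R3 => w 0) h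
  simp at h0
  obtain ⟨h3, h4⟩ := hlt r hr1 hr2
  obtain ⟨h5, h6⟩ := hlt s hs1 hs2
  have h7 : k = m := by
    have h8 : (k : ℝ) < m + 1 := by linarith
    have h9 : (m : ℝ) < k + 1 := by linarith
    norm_cast at h8 h9
    lia
  subst h7
  rw [pinchArc_injective hc (add_right_cancel h)]

theorem norm_periodicArc_sub_le {c : ℝ → R3} {K : ℝ} (hK : ∀ u, ‖c u - u • axis‖ ≤ K) (u : ℝ) :
    ‖periodicArc c u - u • axis‖ ≤ K * (2 * K + 2) := by
  have hK0 : 0 ≤ K := (norm_nonneg _).trans (hK 0)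
  rw [periodicArc, add_sub_cancel_left]
  refine (norm_pinchArc_sub_le hK _).trans ?_
  refine mul_le_of_le_one_right (by positivity) (max_le ?_ zero_le_one)
  linarith [abs_nonneg (2 * Int.fract ((u + 1) / 2) - 1)]

/-- The rescaling of the slab `|w 0| < 1` based at the `i`-th copy of the arc. -/
def window (i : ℕ) (w : R3) : R3 :=
  (max (1 - |w 0|) (2 * i + 5 : ℝ)⁻¹)⁻¹ • w - (2 * i + 2 : ℝ) • axis

theorem continuous_window (i : ℕ) : Continuous (window i) := by
  have h : Continuous fun w : R3 => max (1 - |w 0|) (2 * i + 5 : ℝ)⁻¹ := by fun_prop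
  refine ((h.inv₀ fun w => ?_).smul continuous_id).sub continuous_const
  exact (lt_max_of_lt_right (by positivity)).ne'

theorem window_eq {i : ℕ} {w : R3} (hw : (2 * i + 5 : ℝ)⁻¹ ≤ 1 - |w 0|) :
    window i w = unpinch w - (2 * i + 2 : ℝ) • axis := by
  rw [window, max_eq_left hw, unpinch]

/-- A point that a window map sends to the slab `|w 0| ≤ 1` is in the range of linearity. -/
theorem lt_one_sub_abs_of_window {i : ℕ} {w : R3} (hw : |window i w 0| ≤ 1) :
    (2 * i + 5 : ℝ)⁻¹ < 1 - |w 0| := by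
  by_contra! h
  have hp : (0 : ℝ) < 2 * i + 5 := by positivity
  rw [window, max_eq_right h, inv_inv] at hw
  simp at hw
  obtain ⟨h1, h2⟩ := abs_le.1 hw
  have h3 : (2 * i + 5 : ℝ) * (1 - |w 0|) ≤ 1 := by
    have := mul_le_mul_of_nonneg_left h hp.le
    rwa [mul_inv_cancel₀ hp.ne'] at this
  have hi : (0 : ℝ) ≤ i := by positivity
  rcases abs_cases (w 0) with ⟨h4, -⟩ | ⟨h4, -⟩ <;> rw [h4] at h3 <;> nlinarith

/-- The slab containing the `i`-th copy of the arc. -/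
def slab (i : ℕ) : Set R3 :=
  {w | (2 * i + 1 : ℝ) < (2 * i + 2) * w 0} ∩ {w | (2 * i + 4) * w 0 < (2 * i + 3 : ℝ)}

theorem isOpen_slab (i : ℕ) : IsOpen (slab i) :=
  (isOpen_lt continuous_const (by fun_prop)).inter (isOpen_lt (by fun_prop) continuous_const)

theorem convex_slab (i : ℕ) : Convex ℝ (slab i) := by
  have h : ∀ a : ℝ, IsLinearMap ℝ fun w : R3 => a * w 0 := fun a =>
    ⟨fun x y => by simp [mul_add], fun r x => by simp; ring⟩
  exact (convex_halfSpace_gt (h _) _).inter (convex_halfSpace_lt (h _) _)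

theorem abs_unpinch_sub_lt {i : ℕ} {w : R3} (hw : w ∈ slab i) :
    |unpinch w 0 - (2 * i + 2)| < 1 := by
  have h1 : (2 * i + 1 : ℝ) < (2 * i + 2) * w 0 := hw.1
  have h2 : (2 * i + 4) * w 0 < (2 * i + 3 : ℝ) := hw.2
  have hi : (0 : ℝ) ≤ i := by positivity
  have h0 : 0 < w 0 := by
    by_contra! h
    nlinarith
  have h3 : 0 < 1 - w 0 := by
    by_contra! h
    nlinarith
  rw [unpinch_zero_apply, abs_of_pos h0, abs_lt]
  constructor
  · rw [lt_sub_iff_add_lt, lt_inv_mul_iff₀ h3]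
    nlinarith
  · rw [sub_lt_iff_lt_add, inv_mul_lt_iff₀ h3]
    nlinarith

theorem pinch_mem_slab {i : ℕ} {w : R3} (hw : |w 0| < 1) :
    pinch ((2 * i + 2 : ℝ) • axis + w) ∈ slab i := by
  obtain ⟨h1, h2⟩ := abs_lt.1 hw
  have hi : (0 : ℝ) ≤ i := by positivity
  have e : ((2 * i + 2 : ℝ) • axis + w) 0 = 2 * i + 2 + w 0 := by simp
  have hp : 0 < 2 * i + 2 + w 0 := by linarith
  have hq : 0 < 1 + (2 * i + 2 + w 0) := by linarith
  constructor
  · change (2 * i + 1 : ℝ) < (2 * i + 2) * pinch _ 0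
    rw [pinch_zero_apply, e, abs_of_pos hp, ← mul_assoc, mul_comm _ (_)⁻¹, mul_assoc,
      lt_inv_mul_iff₀ hq]
    nlinarith
  · change (2 * i + 4) * pinch _ 0 < (2 * i + 3 : ℝ)
    rw [pinch_zero_apply, e, abs_of_pos hp, ← mul_assoc, mul_comm _ (_)⁻¹, mul_assoc,
      inv_mul_lt_iff₀ hq]
    nlinarith

theorem window_pinch {i : ℕ} {w : R3} (hw : |w 0| < 1) :
    window i (pinch ((2 * i + 2 : ℝ) • axis + w)) = w := by
  obtain ⟨h1, h2⟩ := abs_lt.1 hw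
  have hi : (0 : ℝ) ≤ i := by positivity
  rw [window_eq, unpinch_pinch, add_sub_cancel_left]
  rw [one_sub_abs_pinch]
  have e : ((2 * i + 2 : ℝ) • axis + w) 0 = 2 * i + 2 + w 0 := by simp
  rw [e]
  have hp : 0 < 2 * i + 2 + w 0 := by linarith
  rw [abs_of_pos hp]
  exact inv_anti₀ (by linarith) (by linarith)

theorem LocSys.IsTriv.comp {G ι E X Y : Type*} [Group G] [TopologicalSpace E]
    [TopologicalSpace X] [TopologicalSpace Y] {Z : LocSys G ι E} {S : Set X} {T : Set Y}
    {h : X → E} {l : ι → X → G} (hl : Z.IsTriv S h l) {ψ : Y → X} (hψ : ContinuousOn ψ T)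
    (hmaps : MapsTo ψ T S) : Z.IsTriv T (h ∘ ψ) fun a => l a ∘ ψ where
  locConst a x hx ha :=
    ((hψ x hx).tendsto_nhdsWithin hmaps).eventually (hl.locConst a (ψ x) (hmaps hx) ha)
  g_mul a b x hx := hl.g_mul a b (ψ x) (hmaps hx)

/-- If the complement of a pinched arc carries a finite group valued cocycle which is nontrivial
over some compact set, then a suitable chain of copies of the arc is not an attractor. -/
theorem exists_arc_of_locSys {G ι : Type*} [Group G] [Finite G] (Z : LocSys G ι R3)
    {c : ℝ → R3} (hc : Continuous c) (hinj : Function.Injective c) {K : ℝ}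
    (hK : ∀ u, ‖c u - u • axis‖ ≤ K) (hZ : (pinchArc c '' Icc (-1) 1)ᶜ ⊆ Z.domain)
    {Γ : Set R3} (hΓ : IsCompact Γ) (hΓ1 : ∀ w ∈ Γ, |w 0| < 1)
    (hΓc : Disjoint Γ (pinchArc c '' Icc (-1) 1)) (hnt : ∀ l, ¬ Z.IsTriv Γ id l) :
    ∃ A : Set R3, IsCompact A ∧ Nonempty (↥A ≃ₜ ↥(Set.Icc (0 : ℝ) 1)) ∧
      ∀ U : Set R3, IsOpen U → A ⊆ U →
        ∀ f : ↥U → ↥U, Continuous f → Function.Injective f → ¬ IsAttractor f A := by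
  have hd := continuous_periodicArc hc hK
  have hdinj := periodicArc_injective hinj
  have hdK := norm_periodicArc_sub_le hK
  set d := periodicArc c with hd_def
  have ha := continuous_pinchArc hd hdK
  have hainj := pinchArc_injective hdinj
  set C := pinchArc c '' Icc (-1) 1 with hC
  have hA : IsCompact (pinchArc d '' Icc (-1) 1) := isCompact_Icc.image ha
  have hC1 : ∀ w ∈ C, |w 0| ≤ 1 := by
    rintro _ ⟨r, hr, rfl⟩
    exact abs_pinchArc_le c (abs_le.2 hr)
  have hmem : ∀ (i : ℕ) (w : R3), |window i w 0| ≤ 1 → window i w ∈ C →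
      w ∈ pinchArc d '' Icc (-1) 1 := by
    intro i w h1 hw
    have h2 := lt_one_sub_abs_of_window h1
    have h3 : |w 0| < 1 := by
      have : (0 : ℝ) < (2 * i + 5 : ℝ)⁻¹ := by positivity
      linarith
    rw [window_eq h2.le] at hw
    obtain ⟨r, hr, hrw⟩ := hw
    have h4 := periodicArc_add c (i + 1) (abs_le.2 hr)
    rw [hrw, ← hd_def] at h4
    push_cast at h4
    rw [show (2 * (i + 1) : ℝ) = 2 * i + 2 by ring, sub_add_cancel] at h4
    have h5 := pinchArc_inv_mul d (r + (2 * i + 2))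
    rw [h4, pinch_unpinch h3] at h5
    refine ⟨_, abs_le.1 ?_, h5⟩
    have h6 := abs_pinch_lt ((r + (2 * i + 2) : ℝ) • axis)
    simpa [pinch_zero_apply] using h6.le
  refine ⟨pinchArc d '' Icc (-1) 1, hA, ?_, fun U hU _ f hf hfi => ?_⟩
  · let e : Icc (-1 : ℝ) 1 ≃ pinchArc d '' Icc (-1) 1 :=
      Equiv.Set.image (pinchArc d) (Icc (-1) 1) hainj
    have he : Continuous e := (ha.comp continuous_subtype_val).subtype_mk _
    exact ⟨he.homeoOfEquivCompactToT2.symm.trans (iccHomeoI (-1 : ℝ) 1 (by norm_num))⟩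
  refine not_isAttractor_of_locSys (Z := Z) hA (h := window) (B := slab)
    (Γ := fun i => (fun w => pinch ((2 * i + 2 : ℝ) • axis + w)) '' Γ) continuous_window
    (fun i w hw => hZ fun h => hw (hmem i w (hC1 _ h) h)) isOpen_slab convex_slab
    (fun i j hij w hw => hZ fun h => ?_) (fun i => ?_) (fun i => ?_) (fun i => ?_)
    (fun i l hl => ?_) hU hf hfi
  · have h1 := hC1 _ h
    rw [window_eq (lt_one_sub_abs_of_window h1).le] at h1
    simp at h1
    obtain ⟨h2, h3⟩ := abs_le.1 h1
    obtain ⟨h4, h5⟩ := abs_lt.1 (abs_unpinch_sub_lt hw)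
    have h6 : (i : ℝ) < j + 1 := by linarith
    have h7 : (j : ℝ) < i + 1 := by linarith
    norm_cast at h6 h7
    lia
  · exact hΓ.image (continuous_pinch.comp (by fun_prop))
  · rintro _ ⟨w, hw, rfl⟩
    exact pinch_mem_slab (hΓ1 w hw)
  · rw [Set.disjoint_left]
    rintro _ ⟨w, hw, rfl⟩ ⟨u, hu, huw⟩
    have hu1 : |u| < 1 := by
      by_contra! h
      have h1 := abs_pinch_lt ((2 * i + 2 : ℝ) • axis + w)
      simp only at huw
      rw [← huw, pinchArc_of_le d h] at h1
      simp at h1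
      linarith
    rw [pinchArc_of_lt d hu1] at huw
    have h2 := pinch_injective huw
    obtain ⟨k, r, hr1, hr2, hr⟩ := exists_eq_add_two_mul ((1 - |u|)⁻¹ * u)
    rw [hr, hd_def, periodicArc_add c k (abs_le.2 ⟨hr1, hr2.le⟩)] at h2
    have hrC : pinchArc c r ∈ C := ⟨r, ⟨hr1, hr2.le⟩, rfl⟩
    have h0 := congrArg (fun w : R3 => w 0) h2
    simp at h0
    obtain ⟨h3, h4⟩ := abs_le.1 (hC1 _ hrC)
    obtain ⟨h5, h6⟩ := abs_lt.1 (hΓ1 w hw)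
    have h7 : k = i + 1 := by
      have h8 : (k : ℝ) < i + 2 := by linarith
      have h9 : (i : ℝ) < k := by linarith
      norm_cast at h8 h9
      lia
    subst h7
    push_cast at h2
    rw [show (2 * (i + 1) : ℝ) = 2 * i + 2 by ring, add_comm] at h2
    rw [add_left_cancel h2] at hrC
    exact Set.disjoint_left.1 hΓc hw hrC
  · have hcomp := hl.comp (ψ := fun w => pinch ((2 * i + 2 : ℝ) • axis + w)) (T := Γ)
      (continuous_pinch.comp (by fun_prop)).continuousOn (mapsTo_image _ _)
    refine hnt (fun a => l a ∘ fun w => pinch ((2 * i + 2 : ℝ) • axis + w))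
      ⟨fun a x hx ha => ?_, fun a b x hx ha hb => ?_⟩
    · have := hcomp.locConst a x hx
      simp only [Function.comp_apply, window_pinch (hΓ1 x hx)] at this
      exact this ha
    · have := hcomp.g_mul a b x hx
      simp only [Function.comp_apply, window_pinch (hΓ1 x hx)] at this
      exact this ha hb

/-- A labelling by a group of the regions of a planar grid diagram. The strands of the diagram
are the lattice path `P`: horizontal strands run at height `0` in the `x` direction and at
height `2` in the `y` direction. -/
structure Diagram (G : Type*) [Group G] where
  P : Set (ℤ × ℤ × ℤ)
  γ : ℤ → ℤ → G
  eq_below : ∀ i j, γ i j = γ i (j - 1) ∨ (i, j, 0) ∈ P ∧ (i + 1, j, 0) ∈ P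
  eq_left : ∀ i j, γ i j = γ (i - 1) j ∨ (i, j, 2) ∈ P ∧ (i, j + 1, 2) ∈ P
  inv_mul_eq : ∀ i j, (γ i j)⁻¹ * γ (i - 1) j = (γ i (j - 1))⁻¹ * γ (i - 1) (j - 1) ∨
    (i, j, 1) ∈ P
  eq_one : ∀ i j, 19 ≤ |j| → γ i j = 1

/-- The unit cube with lowest corner `q` has `v` as a corner. -/
def IsCubeCorner (q v : ℤ × ℤ × ℤ) : Prop :=
  (q.1 = v.1 ∨ q.1 = v.1 - 1) ∧ (q.2.1 = v.2.1 ∨ q.2.1 = v.2.1 - 1) ∧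
    (q.2.2 = v.2.2 ∨ q.2.2 = v.2.2 - 1)

namespace Diagram

variable {G : Type*} [Group G] (D : Diagram G)

/-- The jump of the labelling across a strand at height `2`. -/
def jump (i j : ℤ) : G := (D.γ i j)⁻¹ * D.γ (i - 1) j

/-- The transition from a fixed frame to the frame at the lattice point `v` along the cube `q`. -/
def frame (q v : ℤ × ℤ × ℤ) : G :=
  if 2 ≤ v.2.2 then 1 else if v.2.2 = 1 then (if q.1 = v.1 then 1 else D.jump v.1 v.2.1)
  else if 0 ≤ q.2.2 then D.γ q.1 q.2.1 else 1

theorem frame_top {q v : ℤ × ℤ × ℤ} (hv : 2 ≤ v.2.2) : D.frame q v = 1 := if_pos hv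

theorem frame_middle {q v : ℤ × ℤ × ℤ} (hv : v.2.2 = 1) :
    D.frame q v = if q.1 = v.1 then 1 else D.jump v.1 v.2.1 := by
  rw [frame, if_neg (by lia), if_pos hv]

theorem frame_bottom {q v : ℤ × ℤ × ℤ} (hv : v.2.2 ≤ 0) :
    D.frame q v = if 0 ≤ q.2.2 then D.γ q.1 q.2.1 else 1 := by
  rw [frame, if_neg (by lia), if_neg (by lia)]

theorem jump_eq {i j : ℤ} (h : (i, j, 1) ∉ D.P) : D.jump i j = D.jump i (j - 1) :=
  (D.inv_mul_eq i j).resolve_right h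

theorem jump_eq_one {i j : ℤ} (h : ¬((i, j, 2) ∈ D.P ∧ (i, j + 1, 2) ∈ D.P)) :
    D.jump i j = 1 := by
  rw [jump, (D.eq_left i j).resolve_right h, inv_mul_cancel]

theorem frame_middle_eq_frame_middle {q u v : ℤ × ℤ × ℤ} (hu : u ∉ D.P) (hv : v ∉ D.P)
    (hu1 : u.2.2 = 1) (hv1 : v.2.2 = 1) (hx : u.1 = v.1) (hqu : IsCubeCorner q u)
    (hqv : IsCubeCorner q v) : D.frame q u = D.frame q v := by
  obtain ⟨x, y, z⟩ := u
  obtain ⟨x', y', z'⟩ := v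
  obtain ⟨a, b, c⟩ := q
  simp only [IsCubeCorner] at *
  subst hx hu1 hv1
  rw [frame_middle D rfl, frame_middle D rfl]
  simp only
  have h : y = y' ∨ y' = y - 1 ∨ y = y' - 1 := by lia
  rcases h with rfl | rfl | rfl
  · rfl
  · rw [D.jump_eq hu]
  · rw [D.jump_eq hv]

theorem frame_bottom_middle {q q' u v : ℤ × ℤ × ℤ} (hu : u ∉ D.P) (hv : v ∉ D.P)
    (hu0 : u.2.2 ≤ 0) (hv1 : v.2.2 = 1) (hqu : IsCubeCorner q u) (hqv : IsCubeCorner q v)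
    (hqu' : IsCubeCorner q' u)
    (hqv' : IsCubeCorner q' v) :
    D.frame q v * (D.frame q u)⁻¹ = D.frame q' v * (D.frame q' u)⁻¹ := by
  obtain ⟨x, y, z⟩ := u
  obtain ⟨i, j, z'⟩ := v
  obtain ⟨a, b, c⟩ := q
  obtain ⟨a', b', c'⟩ := q'
  simp only [IsCubeCorner] at *
  subst hv1
  obtain rfl : c = 0 := by lia
  obtain rfl : c' = 0 := by lia
  obtain rfl : z = 0 := by lia
  rw [frame_middle D rfl, frame_bottom D le_rfl, frame_middle D rfl, frame_bottom D le_rfl]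
  simp only [le_refl, if_true]
  have key : ∀ b, (b = j ∨ b = j - 1) →
      D.jump i j * (D.γ (i - 1) b)⁻¹ = (D.γ i b)⁻¹ := by
    rintro b (rfl | rfl)
    · rw [jump, mul_inv_cancel_right]
    · rw [D.jump_eq hv, jump, mul_inv_cancel_right]
  by_cases hb : b = b'
  · subst hb
    rcases hqv.1 with rfl | rfl <;> rcases hqv'.1 with rfl | rfl <;>
      simp [key b hqv.2.1]
  obtain rfl : y = j := by lia
  have hb1 : ∀ a, (a = x ∨ a = x - 1) → D.γ a b = D.γ a b' := by
    intro a ha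
    have h1 : D.γ a y = D.γ a (y - 1) := by
      refine (D.eq_below a y).resolve_right fun h => ?_
      rcases ha with rfl | rfl
      · exact hu h.1
      · rw [sub_add_cancel] at h
        exact hu h.2
    rcases hqv.2.1 with rfl | rfl <;> rcases hqv'.2.1 with rfl | rfl <;>
      first | rfl | exact h1 | exact h1.symm
  rw [hb1 a hqu.1]
  rcases hqv.1 with rfl | rfl <;> rcases hqv'.1 with rfl | rfl <;>
    simp [key b' hqv'.2.1]

theorem frame_middle_top {q q' u v : ℤ × ℤ × ℤ} (hu : u ∉ D.P) (hv : v ∉ D.P)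
    (hu1 : u.2.2 = 1) (hv2 : 2 ≤ v.2.2) (hqu : IsCubeCorner q u) (hqv : IsCubeCorner q v)
    (hqu' : IsCubeCorner q' u)
    (hqv' : IsCubeCorner q' v) : D.frame q u = D.frame q' u := by
  obtain ⟨i, j, z⟩ := u
  obtain ⟨x, y, z'⟩ := v
  obtain ⟨a, b, c⟩ := q
  obtain ⟨a', b', c'⟩ := q'
  simp only [IsCubeCorner] at *
  subst hu1
  obtain rfl : z' = 2 := by lia
  rw [frame_middle D rfl, frame_middle D rfl]
  simp only
  by_cases ha : a = a'
  · rw [ha]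
  obtain rfl : x = i := by lia
  have h1 : D.jump x j = 1 := by
    have h : y = j ∨ y = j + 1 ∨ y = j - 1 := by lia
    rcases h with rfl | rfl | rfl
    · exact D.jump_eq_one fun h => hv h.1
    · exact D.jump_eq_one fun h => hv h.2
    · rw [D.jump_eq hu]
      exact D.jump_eq_one fun h => hv h.1
  simp [h1]

/-- The change of frame between two lattice points off the path does not depend on the cube. -/
theorem frame_mul_inv_eq {q q' u v : ℤ × ℤ × ℤ} (hu : u ∉ D.P) (hv : v ∉ D.P)
    (hqu : IsCubeCorner q u) (hqv : IsCubeCorner q v) (hqu' : IsCubeCorner q' u)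
    (hqv' : IsCubeCorner q' v) :
    D.frame q v * (D.frame q u)⁻¹ = D.frame q' v * (D.frame q' u)⁻¹ := by
  wlog huv : u.2.2 ≤ v.2.2 generalizing u v
  · have := congrArg (·⁻¹) (this hv hu hqv hqu hqv' hqu' (by lia))
    simpa using this
  have hd : v.2.2 ≤ u.2.2 + 1 := by
    have h1 := hqu.2.2
    have h2 := hqv.2.2
    lia
  rcases lt_trichotomy v.2.2 1 with h | h | h
  · rw [frame_bottom D (v := v) (by lia), frame_bottom D (v := v) (by lia),
      frame_bottom D (v := u) (by lia), frame_bottom D (v := u) (by lia), mul_inv_cancel,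
      mul_inv_cancel]
  · rcases huv.lt_or_eq with h' | h'
    · exact D.frame_bottom_middle hu hv (by lia) h hqu hqv hqu' hqv'
    · by_cases hx : u.1 = v.1
      · rw [D.frame_middle_eq_frame_middle hu hv (by lia) h hx hqu hqv,
          D.frame_middle_eq_frame_middle hu hv (by lia) h hx hqu' hqv', mul_inv_cancel,
          mul_inv_cancel]
      · have hqq : q.1 = q'.1 := by
          have h1 := hqu.1
          have h2 := hqv.1
          have h3 := hqu'.1
          have h4 := hqv'.1
          lia
        rw [frame_middle D h, frame_middle D h, frame_middle D (h'.trans h),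
          frame_middle D (h'.trans h), hqq]
  · rw [D.frame_top (by lia), D.frame_top (v := v) (by lia)]
    rcases lt_or_ge u.2.2 2 with h' | h'
    · rw [D.frame_middle_top hu hv (by lia) (by lia) hqu hqv hqu' hqv']
    · rw [D.frame_top h', D.frame_top h']

/-- Frames far from the path are trivial. -/
theorem frame_eq_one {q v : ℤ × ℤ × ℤ} (hq : IsCubeCorner q v)
    (h : 20 ≤ |q.2.1| ∨ 20 ≤ |q.2.2|) : D.frame q v = 1 := by
  obtain ⟨-, h1, h2⟩ := hq
  rw [le_abs, le_abs] at h
  rcases lt_trichotomy v.2.2 1 with h0 | h0 | h0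
  · rw [frame_bottom D (by lia)]
    split_ifs with h3
    · refine D.eq_one _ _ (le_abs.2 ?_)
      lia
    · rfl
  · rw [frame_middle D h0, jump, D.eq_one _ _ (le_abs.2 (by lia)),
      D.eq_one _ _ (le_abs.2 (by lia))]
    simp
  · exact D.frame_top (by lia)

end Diagram

/-- The open box of points whose coordinates differ by less than one from those of `v`. -/
def box (v : ℤ × ℤ × ℤ) : Set R3 := {x | |x 0 - v.1| < 1 ∧ |x 1 - v.2.1| < 1 ∧ |x 2 - v.2.2| < 1}

/-- The lowest corner of the unit cube containing `x`. -/
def cube (x : R3) : ℤ × ℤ × ℤ := (⌊x 0⌋, ⌊x 1⌋, ⌊x 2⌋)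

theorem isOpen_box (v : ℤ × ℤ × ℤ) : IsOpen (box v) := by
  have h : ∀ (i : Fin 3) (a : ℝ), IsOpen {x : R3 | |x i - a| < 1} := fun i a =>
    isOpen_lt (by fun_prop) continuous_const
  exact (h 0 _).inter ((h 1 _).inter (h 2 _))

theorem floor_eq_or_eq_sub_one {t : ℝ} {n : ℤ} (h : |t - n| < 1) : ⌊t⌋ = n ∨ ⌊t⌋ = n - 1 := by
  obtain ⟨h1, h2⟩ := abs_lt.1 h
  have h3 : n - 1 ≤ ⌊t⌋ := Int.le_floor.2 (by push_cast; linarith)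
  have h4 : ⌊t⌋ < n + 1 := Int.floor_lt.2 (by push_cast; linarith)
  lia

theorem isCubeCorner_of_mem_box {x : R3} {v : ℤ × ℤ × ℤ} (hx : x ∈ box v) :
    IsCubeCorner (cube x) v :=
  ⟨floor_eq_or_eq_sub_one hx.1, floor_eq_or_eq_sub_one hx.2.1, floor_eq_or_eq_sub_one hx.2.2⟩

theorem le_abs_floor {t : ℝ} {n : ℕ} (h : n < |t|) : (n : ℤ) ≤ |⌊t⌋| := by
  rw [le_abs]
  rcases lt_abs.1 h with h | h
  · exact Or.inl (Int.le_floor.2 (by exact_mod_cast h.le))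
  · right
    have : (⌊t⌋ : ℝ) ≤ -n := (Int.floor_le t).trans (by linarith)
    have h1 : ⌊t⌋ ≤ -n := by exact_mod_cast this
    lia

/-- The part of `ℝ³` whose intersection with the slab `|w 0| < 1` is mapped by `unpinch` to the
complement of a neighbourhood of the first coordinate axis. -/
def farRegion : Set R3 := {w | 20 * (1 - |w 0|) < |w 1|} ∪ {w | 20 * (1 - |w 0|) < |w 2|}

theorem isOpen_farRegion : IsOpen farRegion :=
  (isOpen_lt (by fun_prop) (by fun_prop)).union (isOpen_lt (by fun_prop) (by fun_prop))

theorem le_abs_cube_of_mem_farRegion {w : R3} (hw : |w 0| < 1) (h : w ∈ farRegion) :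
    20 ≤ |(cube (unpinch w)).2.1| ∨ 20 ≤ |(cube (unpinch w)).2.2| := by
  have h0 : 0 < 1 - |w 0| := sub_pos.2 hw
  have key : ∀ i : Fin 3, 20 * (1 - |w 0|) < |w i| → 20 ≤ |⌊unpinch w i⌋| := by
    intro i hi
    refine le_abs_floor (n := 20) ?_
    change (_ : ℝ) < |(1 - |w 0|)⁻¹ * w i|
    rw [abs_mul, abs_of_pos (inv_pos.2 h0), lt_inv_mul_iff₀ h0]
    push_cast
    linarith
  exact h.imp (key 1) (key 2)

namespace Diagram

variable {G : Type*} [Group G] (D : Diagram G)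

/-- The open sets of the cocycle of a diagram. -/
def patch : Option (ℤ × ℤ × ℤ) → Set R3
  | none => farRegion
  | some v => {w | |w 0| < 1 ∧ v ∉ D.P ∧ unpinch w ∈ box v}

/-- The frames at the lattice points, extended by the trivial frame on `farRegion`. -/
def frame' (q : ℤ × ℤ × ℤ) : Option (ℤ × ℤ × ℤ) → G
  | none => 1
  | some v => D.frame q v

theorem isOpen_patch (a : Option (ℤ × ℤ × ℤ)) : IsOpen (D.patch a) := by
  rcases a with _ | v
  · exact isOpen_farRegion
  by_cases hv : v ∈ D.P
  · simp [patch, hv]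
  have h1 : IsOpen {w : R3 | |w 0| < 1} := isOpen_lt (by fun_prop) continuous_const
  convert continuousOn_unpinch.isOpen_inter_preimage h1 (isOpen_box v) using 1
  ext w
  simp [patch, hv]

theorem frame'_mul_inv_eq {a b : Option (ℤ × ℤ × ℤ)} {w w' : R3} (ha : w ∈ D.patch a)
    (hb : w ∈ D.patch b) (ha' : w' ∈ D.patch a) (hb' : w' ∈ D.patch b) :
    D.frame' (cube (unpinch w)) b * (D.frame' (cube (unpinch w)) a)⁻¹ =
      D.frame' (cube (unpinch w')) b * (D.frame' (cube (unpinch w')) a)⁻¹ := by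
  have hfar : ∀ v w, w ∈ D.patch (some v) → w ∈ farRegion →
      D.frame (cube (unpinch w)) v = 1 := fun v w hv hw =>
    D.frame_eq_one (isCubeCorner_of_mem_box hv.2.2) (le_abs_cube_of_mem_farRegion hv.1 hw)
  rcases a with _ | u <;> rcases b with _ | v
  · rfl
  · simp only [frame']
    rw [hfar v w hb ha, hfar v w' hb' ha']
  · simp only [frame']
    rw [hfar u w ha hb, hfar u w' ha' hb']
  · exact D.frame_mul_inv_eq ha.2.1 hb.2.1 (isCubeCorner_of_mem_box ha.2.2)
      (isCubeCorner_of_mem_box hb.2.2) (isCubeCorner_of_mem_box ha'.2.2)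
      (isCubeCorner_of_mem_box hb'.2.2)

/-- The cocycle of a labelled diagram. -/
def locSys : LocSys G (Option (ℤ × ℤ × ℤ)) R3 where
  V := D.patch
  isOpen_V := D.isOpen_patch
  g a b w := D.frame' (cube (unpinch w)) b * (D.frame' (cube (unpinch w)) a)⁻¹
  locConst a b x ha hb := by
    filter_upwards [(D.isOpen_patch a).mem_nhds ha, (D.isOpen_patch b).mem_nhds hb]
      with y hya hyb using D.frame'_mul_inv_eq hya hyb ha hb
  cocycle a b c x _ _ _ := by group

end Diagram

/-- The point with given coordinates. -/
def point (x y z : ℝ) : R3 := !₂[x, y, z]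

@[simp] theorem point_apply_zero (x y z : ℝ) : point x y z 0 = x := rfl

@[simp] theorem point_apply_one (x y z : ℝ) : point x y z 1 = y := rfl

@[simp] theorem point_apply_two (x y z : ℝ) : point x y z 2 = z := rfl

theorem continuous_point {f g h : ℝ → ℝ} (hf : Continuous f) (hg : Continuous g)
    (hh : Continuous h) : Continuous fun t => point (f t) (g t) (h t) := by
  refine (PiLp.continuous_toLp 2 fun _ : Fin 3 => ℝ).comp (continuous_pi fun i => ?_)
  fin_cases i
  exacts [hf, hg, hh]

/-- A trivialization is constant along a path inside one of the open sets of the cocycle. -/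
theorem LocSys.IsTriv.eq_of_path {G ι E X : Type*} [Group G] [TopologicalSpace E]
    [TopologicalSpace X] {Z : LocSys G ι E} {S : Set X} {h : X → E} {l : ι → X → G}
    (hl : Z.IsTriv S h l) {σ : ℝ → X} (hσ : Continuous σ) {I : Set ℝ} (hI : IsPreconnected I)
    (hS : MapsTo σ I S) {a : ι} (ha : ∀ t ∈ I, h (σ t) ∈ Z.V a) {s t : ℝ} (hs : s ∈ I)
    (ht : t ∈ I) : l a (σ s) = l a (σ t) := by
  let _ : TopologicalSpace G := ⊥
  have _ : DiscreteTopology G := ⟨rfl⟩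
  refine hI.constant (f := fun t => l a (σ t)) (fun r hr => ?_) hs ht
  rw [ContinuousWithinAt, nhds_discrete G, Filter.tendsto_pure]
  exact (hσ.continuousWithinAt.tendsto_nhdsWithin hS).eventually
    (hl.locConst a (σ r) (hS hr) (ha r hr))

namespace Diagram

variable {G : Type*} [Group G] (D : Diagram G)

theorem mem_patch_pinch {v : ℤ × ℤ × ℤ} (hv : v ∉ D.P) {x : R3} (hx : x ∈ box v) :
    pinch x ∈ D.patch (some v) :=
  ⟨abs_pinch_lt x, hv, by rwa [unpinch_pinch]⟩

theorem g_pinch (u v : ℤ × ℤ × ℤ) (x : R3) :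
    D.locSys.g (some u) (some v) (pinch x) = D.frame (cube x) v * (D.frame (cube x) u)⁻¹ := by
  change D.frame _ v * (D.frame _ u)⁻¹ = _
  rw [unpinch_pinch]

/-- The `t`-th point of the side in direction `a` of the square around the point `(i, j, 0)` in
the plane with first coordinate `i`. -/
def side (i j : ℤ) : Fin 4 → ℝ → R3
  | 0 => fun t => point i (j + t) (1 / 2)
  | 1 => fun t => point i (j + 1 / 2) t
  | 2 => fun t => point i (j + t) (-1 / 2)
  | 3 => fun t => point i (j - 1 / 2) t

theorem continuous_side (i j : ℤ) (a : Fin 4) : Continuous (side i j a) := by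
  fin_cases a <;> exact continuous_point (by fun_prop) (by fun_prop) (by fun_prop)

/-- The square around the point `(i, j, 0)`, pinched. -/
def loop (i j : ℤ) : Set R3 := ⋃ a : Fin 4, (pinch ∘ side i j a) '' Icc (-1 / 2) (1 / 2)

/-- The centre of the box containing a side of the square around `(i, j, 0)`. -/
def centre (i j : ℤ) : Fin 4 → ℤ × ℤ × ℤ
  | 0 => (i, j, 1)
  | 1 => (i, j + 1, 0)
  | 2 => (i, j, -1)
  | 3 => (i, j - 1, 0)

theorem isCompact_loop (i j : ℤ) : IsCompact (loop i j) :=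
  isCompact_iUnion fun a => isCompact_Icc.image (continuous_pinch.comp (continuous_side i j a))

theorem side_mem_box {i j : ℤ} (a : Fin 4) {t : ℝ} (ht : t ∈ Icc (-1 / 2 : ℝ) (1 / 2)) :
    side i j a t ∈ box (centre i j a) := by
  obtain ⟨h1, h2⟩ := ht
  fin_cases a <;> simp only [box, side, centre, mem_ofPred_eq, point_apply_zero, point_apply_one,
    point_apply_two, abs_lt] <;> push_cast <;> refine ⟨⟨?_, ?_⟩, ⟨?_, ?_⟩, ?_, ?_⟩ <;> linarith

theorem loop_subset_patch {i j : ℤ} (hP : ∀ a, centre i j a ∉ D.P) {w : R3} (hw : w ∈ loop i j) :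
    ∃ v, w ∈ D.patch (some v) := by
  obtain ⟨a, t, ht, rfl⟩ := mem_iUnion.1 hw
  exact ⟨centre i j a, D.mem_patch_pinch (hP a) (side_mem_box a ht)⟩

/-- The cocycle of a diagram has nontrivial monodromy around a horizontal strand separating two
regions with different labels. -/
theorem not_isTriv_loop {i j : ℤ} (hP : ∀ a, centre i j a ∉ D.P) (hγ : D.γ i j ≠ D.γ i (j - 1))
    (l : Option (ℤ × ℤ × ℤ) → R3 → G) : ¬ D.locSys.IsTriv (loop i j) id l := by
  intro hl
  have hl' : ∀ a, ∀ s ∈ Icc (-1 / 2 : ℝ) (1 / 2), ∀ t ∈ Icc (-1 / 2 : ℝ) (1 / 2),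
      l (some (centre i j a)) (pinch (side i j a s)) =
        l (some (centre i j a)) (pinch (side i j a t)) := fun a s hs t ht =>
    hl.eq_of_path (a := some (centre i j a)) (continuous_pinch.comp (continuous_side i j a))
      isPreconnected_Icc (fun r hr => mem_iUnion.2 ⟨a, r, hr, rfl⟩)
      (fun r hr => D.mem_patch_pinch (hP a) (side_mem_box a hr)) hs ht
  have hg : ∀ a b, ∀ s ∈ Icc (-1 / 2 : ℝ) (1 / 2), ∀ t ∈ Icc (-1 / 2 : ℝ) (1 / 2),
      side i j a s = side i j b t →
      D.frame (cube (side i j a s)) (centre i j b) *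
        (D.frame (cube (side i j a s)) (centre i j a))⁻¹ *
          l (some (centre i j a)) (pinch (side i j a s)) =
        l (some (centre i j b)) (pinch (side i j b t)) := by
    intro a b s hs t ht hst
    rw [← D.g_pinch, ← hst]
    refine hl.g_mul _ _ _ (mem_iUnion.2 ⟨a, s, hs, rfl⟩)
      (D.mem_patch_pinch (hP a) (side_mem_box a hs)) (D.mem_patch_pinch (hP b) ?_)
    rw [hst]
    exact side_mem_box b ht
  have hm : (-1 / 2 : ℝ) ∈ Icc (-1 / 2 : ℝ) (1 / 2) := by constructor <;> norm_num
  have hp : (1 / 2 : ℝ) ∈ Icc (-1 / 2 : ℝ) (1 / 2) := by constructor <;> norm_num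
  have h01 := hg 0 1 _ hp _ hp rfl
  have h03 := hg 0 3 _ hm _ hp (by simp only [side]; ring_nf)
  have h21 := hg 2 1 _ hp _ hm rfl
  have h23 := hg 2 3 _ hm _ hm (by simp only [side]; ring_nf)
  have e0 := hl' 0 _ hm _ hp
  have e1 := hl' 1 _ hm _ hp
  have e2 := hl' 2 _ hm _ hp
  have e3 := hl' 3 _ hm _ hp
  have f1 : ⌊(j : ℝ) + 1 / 2⌋ = j := Int.floor_eq_iff.2 ⟨by linarith, by linarith⟩
  have f2 : ⌊(j : ℝ) + -1 / 2⌋ = j - 1 :=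
    Int.floor_eq_iff.2 ⟨by push_cast; linarith, by push_cast; linarith⟩
  have f3 : ⌊(1 / 2 : ℝ)⌋ = 0 := Int.floor_eq_iff.2 ⟨by norm_num, by norm_num⟩
  have f4 : ⌊(-1 / 2 : ℝ)⌋ = -1 := Int.floor_eq_iff.2 ⟨by norm_num, by norm_num⟩
  have c0p : cube (side i j 0 (1 / 2)) = (i, j, 0) := by
    simp only [cube, side, point_apply_zero, point_apply_one, point_apply_two, f1, f3,
      Int.floor_intCast]
  have c0m : cube (side i j 0 (-1 / 2)) = (i, j - 1, 0) := by
    simp only [cube, side, point_apply_zero, point_apply_one, point_apply_two, f2, f3,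
      Int.floor_intCast]
  rw [c0p] at h01
  rw [c0m] at h03
  simp only [centre] at h01 h03 h21 h23 e0 e1 e2 e3
  rw [D.frame_bottom le_rfl, D.frame_middle rfl] at h01 h03
  rw [D.frame_bottom le_rfl, D.frame_bottom (by norm_num), mul_inv_cancel, one_mul] at h21 h23
  simp only [if_true, inv_one, mul_one, le_refl] at h01 h03
  rw [← e1, ← h21, ← e2, h23, e3, ← h03, e0] at h01
  exact hγ (mul_right_cancel h01)

end Diagram

/-- The taxicab distance between lattice points. -/
def taxicab (p q : ℤ × ℤ × ℤ) : ℤ := |p.1 - q.1| + |p.2.1 - q.2.1| + |p.2.2 - q.2.2|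

/-- An induced path in the graph of nearest neighbours of the lattice `ℤ³`. -/
structure IsInducedPath (v : ℤ → ℤ × ℤ × ℤ) : Prop where
  taxicab_succ : ∀ k, taxicab (v k) (v (k + 1)) = 1
  abs_sub_le : ∀ k l, taxicab (v k) (v l) ≤ 1 → |k - l| ≤ 1

/-- The lattice point with given coordinates. -/
def latticePoint (p : ℤ × ℤ × ℤ) : R3 := point p.1 p.2.1 p.2.2

/-- The point at parameter `t` on the segment between two lattice points. -/
def edgePoint (p q : ℤ × ℤ × ℤ) (t : ℝ) : R3 :=
  latticePoint p + t • (latticePoint q - latticePoint p)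

/-- The piecewise linear curve through a sequence of lattice points. -/
def latticeCurve (v : ℤ → ℤ × ℤ × ℤ) (s : ℝ) : R3 :=
  edgePoint (v ⌊s⌋) (v (⌊s⌋ + 1)) (Int.fract s)

theorem edgePoint_eq_point (p q : ℤ × ℤ × ℤ) (t : ℝ) :
    edgePoint p q t = point (p.1 + t * (q.1 - p.1)) (p.2.1 + t * (q.2.1 - p.2.1))
      (p.2.2 + t * (q.2.2 - p.2.2)) := by
  ext i
  fin_cases i <;> rfl

theorem point_ext {x y : R3} (h0 : x 0 = y 0) (h1 : x 1 = y 1) (h2 : x 2 = y 2) : x = y := by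
  ext i
  fin_cases i
  exacts [h0, h1, h2]

theorem edgePoint_zero (p q : ℤ × ℤ × ℤ) : edgePoint p q 0 = latticePoint p := by
  simp [edgePoint]

theorem edgePoint_one (p q : ℤ × ℤ × ℤ) : edgePoint p q 1 = latticePoint q := by
  simp [edgePoint]

theorem edgePoint_one_sub (p q : ℤ × ℤ × ℤ) (t : ℝ) :
    edgePoint p q (1 - t) = edgePoint q p t := by
  simp only [edgePoint]
  module

theorem latticeCurve_add (v : ℤ → ℤ × ℤ × ℤ) (k : ℤ) {t : ℝ} (h0 : 0 ≤ t) (h1 : t ≤ 1) :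
    latticeCurve v (k + t) = edgePoint (v k) (v (k + 1)) t := by
  rcases h1.lt_or_eq with h1 | rfl
  · have h2 : Int.fract t = t := Int.fract_eq_self.2 ⟨h0, h1⟩
    have h3 : ⌊t⌋ = 0 := Int.floor_eq_zero_iff.2 ⟨h0, h1⟩
    rw [latticeCurve, Int.floor_intCast_add, Int.fract_intCast_add, h2, h3, add_zero]
  · have h2 : (k : ℝ) + 1 = ((k + 1 : ℤ) : ℝ) := by push_cast; rfl
    rw [latticeCurve, h2, Int.floor_intCast, Int.fract_intCast, edgePoint_zero, edgePoint_one]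

theorem continuous_latticeCurve (v : ℤ → ℤ × ℤ × ℤ) : Continuous (latticeCurve v) := by
  have hcov : ⋃ k : ℤ, Icc (k : ℝ) (k + 1) = univ := iUnion_Icc_intCast ℝ
  have hlf : LocallyFinite fun k : ℤ => Icc (k : ℝ) (k + 1) := by
    intro x
    refine ⟨Ioo (x - 1) (x + 1), Ioo_mem_nhds (by linarith) (by linarith),
      (finite_Icc (⌊x⌋ - 3) (⌊x⌋ + 3)).subset ?_⟩
    rintro k ⟨y, ⟨h1, h2⟩, h3, h4⟩
    have h5 := Int.floor_le x
    have h6 := Int.lt_floor_add_one x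
    constructor
    · have : (⌊x⌋ : ℝ) - 3 < k := by linarith
      exact_mod_cast this.le
    · have : (k : ℝ) < ⌊x⌋ + 3 := by linarith
      exact_mod_cast this.le
  refine hlf.continuous hcov (fun k => isClosed_Icc) fun k => ?_
  have h1 : Continuous fun s : ℝ => edgePoint (v k) (v (k + 1)) (s - k) := by
    unfold edgePoint
    fun_prop
  refine h1.continuousOn.congr fun s hs => ?_
  have := latticeCurve_add v k (t := s - k) (by linarith [hs.1]) (by linarith [hs.2])
  rwa [add_sub_cancel] at this

theorem norm_latticeCurve_sub_le {v : ℤ → ℤ × ℤ × ℤ} {K ρ : ℝ}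
    (hK : ∀ k : ℤ, ‖latticePoint (v k) - (ρ * k) • axis‖ ≤ K) (s : ℝ) :
    ‖latticeCurve v s - (ρ * s) • axis‖ ≤ K := by
  have h0 := Int.fract_nonneg s
  have h1 := (Int.fract_lt_one s).le
  set t := Int.fract s with ht
  have e : latticeCurve v s - (ρ * s) • axis =
      (1 - t) • (latticePoint (v ⌊s⌋) - (ρ * ⌊s⌋) • axis) +
        t • (latticePoint (v (⌊s⌋ + 1)) - (ρ * (⌊s⌋ + 1 : ℤ)) • axis) := by
    have hs : s = ⌊s⌋ + t := (Int.floor_add_fract s).symm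
    nth_rewrite 2 [hs]
    rw [latticeCurve, edgePoint, ← ht]
    push_cast
    module
  rw [e]
  calc _ ≤ (1 - t) * K + t * K := by
        refine (norm_add_le _ _).trans (add_le_add ?_ ?_)
        · rw [norm_smul, Real.norm_of_nonneg (by linarith)]
          exact mul_le_mul_of_nonneg_left (hK _) (by linarith)
        · rw [norm_smul, Real.norm_of_nonneg h0]
          exact mul_le_mul_of_nonneg_left (hK _) h0
    _ = K := by ring

theorem eq_of_abs_sub_lt_one {a p : ℤ} (h : |(a : ℝ) - p| < 1) : p = a := by
  have h1 : |a - p| < 1 := by exact_mod_cast h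
  rw [abs_lt] at h1
  lia

theorem eq_or_eq_of_abs_lt_one {a b p : ℤ} {t : ℝ} (h0 : 0 ≤ t) (h1 : t < 1)
    (hab : |a - b| = 1) (h : |(a : ℝ) + t * (b - a) - p| < 1) : p = a ∨ 0 < t ∧ p = b := by
  rcases h0.eq_or_lt with rfl | h0
  · rw [zero_mul, add_zero] at h
    exact Or.inl (eq_of_abs_sub_lt_one h)
  obtain ⟨h2, h3⟩ := abs_lt.1 h
  rcases (abs_eq zero_le_one).1 hab with hb | hb
  · obtain rfl : b = a - 1 := by lia
    push_cast at h2 h3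
    have h4 : (p : ℝ) < a + 1 := by linarith
    have h5 : (a : ℝ) - 2 < p := by linarith
    norm_cast at h4 h5
    rcases eq_or_ne p a with h | h
    · exact Or.inl h
    · exact Or.inr ⟨h0, by lia⟩
  · obtain rfl : b = a + 1 := by lia
    push_cast at h2 h3
    have h4 : (p : ℝ) < a + 2 := by linarith
    have h5 : (a : ℝ) - 1 < p := by linarith
    norm_cast at h4 h5
    rcases eq_or_ne p a with h | h
    · exact Or.inl h
    · exact Or.inr ⟨h0, by lia⟩

theorem eq_or_eq_of_edgePoint_mem_box {p q v : ℤ × ℤ × ℤ} (hpq : taxicab p q = 1) {t : ℝ}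
    (h0 : 0 ≤ t) (h1 : t < 1) (h : edgePoint p q t ∈ box v) : v = p ∨ 0 < t ∧ v = q := by
  obtain ⟨x, y, z⟩ := p
  obtain ⟨x', y', z'⟩ := q
  obtain ⟨a, b, c⟩ := v
  rw [edgePoint_eq_point] at h
  obtain ⟨ha, hb, hc⟩ := h
  simp only [point_apply_zero, point_apply_one, point_apply_two] at ha hb hc
  simp only [taxicab] at hpq
  have hx := abs_nonneg (x - x')
  have hy := abs_nonneg (y - y')
  have hz := abs_nonneg (z - z')
  have heq : ∀ {m m' n : ℤ}, |m - m'| = 0 → |(m : ℝ) + t * (m' - m) - n| < 1 →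
      n = m ∧ m' = m := by
    intro m m' n h2 h3
    obtain rfl : m = m' := sub_eq_zero.1 (abs_eq_zero.1 h2)
    rw [sub_self, mul_zero, add_zero] at h3
    exact ⟨eq_of_abs_sub_lt_one h3, rfl⟩
  have hcase : |x - x'| = 1 ∧ |y - y'| = 0 ∧ |z - z'| = 0 ∨
      |x - x'| = 0 ∧ |y - y'| = 1 ∧ |z - z'| = 0 ∨
      |x - x'| = 0 ∧ |y - y'| = 0 ∧ |z - z'| = 1 := by lia
  rcases hcase with ⟨e1, e2, e3⟩ | ⟨e1, e2, e3⟩ | ⟨e1, e2, e3⟩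
  · obtain ⟨rfl, rfl⟩ := heq e2 hb
    obtain ⟨rfl, rfl⟩ := heq e3 hc
    rcases eq_or_eq_of_abs_lt_one h0 h1 e1 ha with rfl | ⟨h2, rfl⟩
    exacts [Or.inl rfl, Or.inr ⟨h2, rfl⟩]
  · obtain ⟨rfl, rfl⟩ := heq e1 ha
    obtain ⟨rfl, rfl⟩ := heq e3 hc
    rcases eq_or_eq_of_abs_lt_one h0 h1 e2 hb with rfl | ⟨h2, rfl⟩
    exacts [Or.inl rfl, Or.inr ⟨h2, rfl⟩]
  · obtain ⟨rfl, rfl⟩ := heq e1 ha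
    obtain ⟨rfl, rfl⟩ := heq e2 hb
    rcases eq_or_eq_of_abs_lt_one h0 h1 e3 hc with rfl | ⟨h2, rfl⟩
    exacts [Or.inl rfl, Or.inr ⟨h2, rfl⟩]

theorem edgePoint_mem_box {p q : ℤ × ℤ × ℤ} (hpq : taxicab p q = 1) {t : ℝ} (h0 : 0 ≤ t)
    (h1 : t < 1) : edgePoint p q t ∈ box p := by
  have key : ∀ m m' : ℤ, |m - m'| ≤ 1 → |(m : ℝ) + t * (m' - m) - m| < 1 := by
    intro m m' h
    have h2 : |(m' : ℝ) - m| ≤ 1 := by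
      rw [abs_sub_comm]
      exact_mod_cast h
    rw [add_sub_cancel_left, abs_mul, abs_of_nonneg h0]
    nlinarith [abs_nonneg ((m' : ℝ) - m)]
  simp only [taxicab] at hpq
  have hx := abs_nonneg (p.1 - q.1)
  have hy := abs_nonneg (p.2.1 - q.2.1)
  have hz := abs_nonneg (p.2.2 - q.2.2)
  rw [edgePoint_eq_point]
  exact ⟨key _ _ (by linarith), key _ _ (by linarith), key _ _ (by linarith)⟩

theorem edgePoint_left_injective {p q : ℤ × ℤ × ℤ} (hpq : taxicab p q = 1) :
    Function.Injective (edgePoint p q) := by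
  intro s t h
  have hne : latticePoint q - latticePoint p ≠ 0 := by
    intro h0
    have h1 : latticePoint q = latticePoint p := sub_eq_zero.1 h0
    have e0 : (q.1 : ℝ) = p.1 := congrArg (fun w : R3 => w 0) h1
    have e1 : (q.2.1 : ℝ) = p.2.1 := congrArg (fun w : R3 => w 1) h1
    have e2 : (q.2.2 : ℝ) = p.2.2 := congrArg (fun w : R3 => w 2) h1
    norm_cast at e0 e1 e2
    simp [taxicab, e0, e1, e2] at hpq
  exact smul_left_injective ℝ hne (add_left_cancel h)

namespace IsInducedPath

variable {v : ℤ → ℤ × ℤ × ℤ}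

theorem injective (hv : IsInducedPath v) : Function.Injective v := by
  intro k l h
  have h1 := hv.abs_sub_le k l (by simp [h, taxicab])
  have h2 := hv.taxicab_succ k
  have h3 := hv.taxicab_succ l
  rcases le_or_gt |k - l| 0 with h4 | h4
  · exact sub_eq_zero.1 (abs_eq_zero.1 (le_antisymm h4 (abs_nonneg _)))
  · rcases (abs_eq zero_le_one).1 (le_antisymm h1 h4) with h5 | h5
    · obtain rfl : k = l + 1 := by lia
      rw [h] at h3
      simp [taxicab] at h3
    · obtain rfl : l = k + 1 := by lia
      rw [h] at h2
      simp [taxicab] at h2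

theorem eq_or_eq_of_mem_box (hv : IsInducedPath v) {s : ℝ} {p : ℤ × ℤ × ℤ}
    (h : latticeCurve v s ∈ box p) : p = v ⌊s⌋ ∨ 0 < Int.fract s ∧ p = v (⌊s⌋ + 1) :=
  eq_or_eq_of_edgePoint_mem_box (hv.taxicab_succ _) (Int.fract_nonneg s) (Int.fract_lt_one s) h

theorem latticeCurve_injective (hv : IsInducedPath v) : Function.Injective (latticeCurve v) := by
  intro s t h
  have key : ∀ s t, latticeCurve v s = latticeCurve v t → ⌊s⌋ = ⌊t⌋ ∨ ⌊s⌋ = ⌊t⌋ + 1 := by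
    intro s t h
    have h1 : latticeCurve v s ∈ box (v ⌊s⌋) :=
      edgePoint_mem_box (hv.taxicab_succ _) (Int.fract_nonneg s) (Int.fract_lt_one s)
    rw [h] at h1
    exact (hv.eq_or_eq_of_mem_box h1).imp (fun h2 => hv.injective h2)
      fun h2 => hv.injective h2.2
  have h1 : ⌊s⌋ = ⌊t⌋ := by
    have h1 := key s t h
    have h2 := key t s h.symm
    lia
  rw [latticeCurve, latticeCurve, h1] at h
  have h2 := edgePoint_left_injective (hv.taxicab_succ _) h
  rw [← Int.floor_add_fract s, h1, h2, Int.floor_add_fract]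

theorem edgePoint_mem_range (hv : IsInducedPath v) {p q : ℤ × ℤ × ℤ} (hp : p ∈ range v)
    (hq : q ∈ range v) (hpq : taxicab p q = 1) {t : ℝ} (h0 : 0 ≤ t) (h1 : t ≤ 1) :
    edgePoint p q t ∈ range (latticeCurve v) := by
  obtain ⟨k, rfl⟩ := hp
  obtain ⟨l, rfl⟩ := hq
  have h2 := hv.abs_sub_le k l hpq.le
  have hkl : k ≠ l := by
    rintro rfl
    simp [taxicab] at hpq
  rw [abs_le] at h2
  have h3 : l = k + 1 ∨ k = l + 1 := by lia
  rcases h3 with rfl | rfl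
  · exact ⟨k + t, latticeCurve_add v k h0 h1⟩
  · refine ⟨l + (1 - t), ?_⟩
    rw [latticeCurve_add v l (by linarith) (by linarith), edgePoint_one_sub]

theorem not_square (hv : IsInducedPath v) {p q r s : ℤ × ℤ × ℤ} (hp : p ∈ range v)
    (hq : q ∈ range v) (hr : r ∈ range v) (hs : s ∈ range v) (hpq : taxicab p q = 1)
    (hpr : taxicab p r = 1) (hqs : taxicab q s = 1) (hrs : taxicab r s = 1)
    (hqr : q ≠ r) (hps : p ≠ s) : False := by
  obtain ⟨a, rfl⟩ := hp
  obtain ⟨b, rfl⟩ := hq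
  obtain ⟨c, rfl⟩ := hr
  obtain ⟨d, rfl⟩ := hs
  have h1 := abs_le.1 (hv.abs_sub_le a b hpq.le)
  have h2 := abs_le.1 (hv.abs_sub_le a c hpr.le)
  have h3 := abs_le.1 (hv.abs_sub_le b d hqs.le)
  have h4 := abs_le.1 (hv.abs_sub_le c d hrs.le)
  have h5 : a ≠ b := by rintro rfl; simp [taxicab] at hpq
  have h6 : a ≠ c := by rintro rfl; simp [taxicab] at hpr
  have h7 : b ≠ c := fun h => hqr (congrArg v h)
  have h8 : a ≠ d := fun h => hps (congrArg v h)
  lia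

/-- A point all of whose nearby lattice points are on the path is on the curve. -/
theorem mem_range_of_forall_box (hv : IsInducedPath v) {x : R3}
    (hx : ∀ p, x ∈ box p → p ∈ range v) : x ∈ range (latticeCurve v) := by
  have hfl : ∀ i, x i = ⌊x i⌋ + Int.fract (x i) := fun i => (Int.floor_add_fract _).symm
  have hf0 : ∀ i, 0 ≤ Int.fract (x i) := fun i => Int.fract_nonneg _
  have hf1 : ∀ i, Int.fract (x i) < 1 := fun i => Int.fract_lt_one _
  have hlo : ∀ i, |x i - ⌊x i⌋| < 1 := fun i => by
    rw [Int.self_sub_floor, abs_of_nonneg (hf0 i)]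
    exact hf1 i
  have hhi : ∀ i, Int.fract (x i) ≠ 0 → |x i - (⌊x i⌋ + 1 : ℤ)| < 1 := fun i hi => by
    have h1 := hfl i
    have h2 := (hf0 i).lt_of_ne' hi
    have h3 := hf1 i
    rw [abs_lt]
    push_cast
    constructor <;> linarith
  set a := ⌊x 0⌋ with ha
  set b := ⌊x 1⌋ with hb
  set c := ⌊x 2⌋ with hc
  have m000 := hx (a, b, c) ⟨hlo 0, hlo 1, hlo 2⟩
  have t1 : taxicab (a, b, c) (a + 1, b, c) = 1 := by simp [taxicab]
  have t2 : taxicab (a, b, c) (a, b + 1, c) = 1 := by simp [taxicab]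
  have t3 : taxicab (a, b, c) (a, b, c + 1) = 1 := by simp [taxicab]
  by_cases e0 : Int.fract (x 0) = 0
  · by_cases e1 : Int.fract (x 1) = 0
    · by_cases e2 : Int.fract (x 2) = 0
      · obtain ⟨k, hk⟩ := m000
        refine ⟨k, ?_⟩
        rw [latticeCurve, Int.floor_intCast, Int.fract_intCast, edgePoint_zero, hk]
        exact point_ext (by rw [hfl 0, e0, add_zero]; rfl) (by rw [hfl 1, e1, add_zero]; rfl)
          (by rw [hfl 2, e2, add_zero]; rfl)
      · have m001 := hx (a, b, c + 1) ⟨hlo 0, hlo 1, hhi 2 e2⟩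
        have := hv.edgePoint_mem_range m000 m001 t3 (hf0 2) (hf1 2).le
        rw [edgePoint_eq_point] at this
        convert this
        refine point_ext ?_ ?_ ?_ <;>
          simp only [point_apply_zero, point_apply_one, point_apply_two]
        · rw [hfl 0, e0, ha]; ring
        · rw [hfl 1, e1, hb]; ring
        · conv_lhs => rw [hfl 2]
          rw [hc]; push_cast; ring
    · have m010 := hx (a, b + 1, c) ⟨hlo 0, hhi 1 e1, hlo 2⟩
      by_cases e2 : Int.fract (x 2) = 0
      · have := hv.edgePoint_mem_range m000 m010 t2 (hf0 1) (hf1 1).le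
        rw [edgePoint_eq_point] at this
        convert this
        refine point_ext ?_ ?_ ?_ <;>
          simp only [point_apply_zero, point_apply_one, point_apply_two]
        · rw [hfl 0, e0, ha]; ring
        · conv_lhs => rw [hfl 1]
          rw [hb]; push_cast; ring
        · rw [hfl 2, e2, hc]; ring
      · have m001 := hx (a, b, c + 1) ⟨hlo 0, hlo 1, hhi 2 e2⟩
        have m011 := hx (a, b + 1, c + 1) ⟨hlo 0, hhi 1 e1, hhi 2 e2⟩
        exact (hv.not_square m000 m010 m001 m011 t2 t3 (by simp [taxicab]) (by simp [taxicab])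
          (by simp) (by simp)).elim
  · have m100 := hx (a + 1, b, c) ⟨hhi 0 e0, hlo 1, hlo 2⟩
    by_cases e1 : Int.fract (x 1) = 0
    · by_cases e2 : Int.fract (x 2) = 0
      · have := hv.edgePoint_mem_range m000 m100 t1 (hf0 0) (hf1 0).le
        rw [edgePoint_eq_point] at this
        convert this
        refine point_ext ?_ ?_ ?_ <;>
          simp only [point_apply_zero, point_apply_one, point_apply_two]
        · conv_lhs => rw [hfl 0]
          rw [ha]; push_cast; ring
        · rw [hfl 1, e1, hb]; ring
        · rw [hfl 2, e2, hc]; ring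
      · have m001 := hx (a, b, c + 1) ⟨hlo 0, hlo 1, hhi 2 e2⟩
        have m101 := hx (a + 1, b, c + 1) ⟨hhi 0 e0, hlo 1, hhi 2 e2⟩
        exact (hv.not_square m000 m100 m001 m101 t1 t3 (by simp [taxicab]) (by simp [taxicab])
          (by simp) (by simp)).elim
    · have m010 := hx (a, b + 1, c) ⟨hlo 0, hhi 1 e1, hlo 2⟩
      have m110 := hx (a + 1, b + 1, c) ⟨hhi 0 e0, hhi 1 e1, hlo 2⟩
      exact (hv.not_square m000 m100 m010 m110 t1 t2 (by simp [taxicab]) (by simp [taxicab])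
        (by simp) (by simp)).elim

end IsInducedPath

namespace Diagram

variable {G : Type*} [Group G] (D : Diagram G)

theorem disjoint_patch_pinchArc {c : ℝ → R3} (hbox : ∀ t p, c t ∈ box p → p ∈ D.P)
    (p : ℤ × ℤ × ℤ) : Disjoint (D.patch (some p)) (pinchArc c '' Icc (-1) 1) := by
  rw [disjoint_left]
  rintro w ⟨h1, h2, h3⟩ ⟨u, hu, rfl⟩
  have hu' : |u| < 1 := by
    by_contra! h
    have h4 : |u| ≤ 1 := abs_le.2 hu
    rw [pinchArc_of_le c h] at h1
    have : |u| < 1 := by simpa using h1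
    exact this.not_ge h
  rw [pinchArc_of_lt c hu', unpinch_pinch] at h3
  exact h2 (hbox _ _ h3)

theorem compl_pinchArc_subset_domain {c : ℝ → R3}
    (hbox : ∀ x, (∀ p, x ∈ box p → p ∈ D.P) → x ∈ range c) :
    (pinchArc c '' Icc (-1) 1)ᶜ ⊆ D.locSys.domain := by
  intro w hw
  refine mem_iUnion.2 ?_
  rcases lt_or_ge |w 0| 1 with h | h
  · have h1 : unpinch w ∉ range c := by
      rintro ⟨t, ht⟩
      refine hw ⟨(1 + |t|)⁻¹ * t, ?_, ?_⟩
      · have h2 := abs_pinch_lt (t • axis)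
        rw [pinch_smul_axis] at h2
        exact abs_le.1 (by simpa using h2.le)
      · rw [pinchArc_inv_mul, ht, pinch_unpinch h]
    have h2 := mt (hbox (unpinch w)) h1
    push Not at h2
    obtain ⟨p, hp, hp'⟩ := h2
    exact ⟨some p, h, hp', hp⟩
  · refine ⟨none, ?_⟩
    by_contra hfar
    change w ∉ farRegion at hfar
    simp only [farRegion, mem_union, mem_ofPred_eq, not_or, not_lt] at hfar
    obtain ⟨h1, h2⟩ := hfar
    have h3 := abs_nonneg (w 1)
    have h4 := abs_nonneg (w 2)
    have h5 : |w 0| = 1 := by linarith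
    have h6 : w 1 = 0 := abs_eq_zero.1 (by linarith)
    have h7 : w 2 = 0 := abs_eq_zero.1 (by linarith)
    refine hw ⟨w 0, abs_le.1 h5.le, ?_⟩
    rw [pinchArc_of_le c h]
    exact point_ext (by simp) (by simp [axis, h6]) (by simp [axis, h7])

/-- The pinched path of a labelled diagram with nontrivial labelling is an arc that is not an
attractor. -/
theorem exists_arc_of_isInducedPath [Finite G] {v : ℤ → ℤ × ℤ × ℤ} (hv : IsInducedPath v)
    (hP : D.P = range v) {K ρ : ℝ} (hρ : 0 < ρ)
    (hK : ∀ k : ℤ, ‖latticePoint (v k) - (ρ * k) • axis‖ ≤ K) {i j : ℤ}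
    (hc : ∀ a, centre i j a ∉ D.P) (hγ : D.γ i j ≠ D.γ i (j - 1)) :
    ∃ A : Set R3, IsCompact A ∧ Nonempty (↥A ≃ₜ ↥(Set.Icc (0 : ℝ) 1)) ∧
      ∀ U : Set R3, IsOpen U → A ⊆ U →
        ∀ f : ↥U → ↥U, Continuous f → Function.Injective f → ¬ IsAttractor f A := by
  have hr : range (fun u => latticeCurve v (ρ⁻¹ * u)) = range (latticeCurve v) :=
    (mul_left_surjective₀ (inv_ne_zero hρ.ne')).range_comp (latticeCurve v)
  refine exists_arc_of_locSys D.locSys (c := fun u => latticeCurve v (ρ⁻¹ * u)) (K := K)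
    (Γ := loop i j) ?_ ?_ ?_ ?_ (isCompact_loop i j) ?_ ?_ (D.not_isTriv_loop hc hγ)
  · exact (continuous_latticeCurve v).comp (by fun_prop)
  · exact hv.latticeCurve_injective.comp (mul_right_injective₀ (inv_ne_zero hρ.ne'))
  · intro u
    simpa [mul_inv_cancel_left₀ hρ.ne'] using norm_latticeCurve_sub_le hK (ρ⁻¹ * u)
  · refine D.compl_pinchArc_subset_domain fun x hx => ?_
    rw [hr]
    exact hv.mem_range_of_forall_box fun p hp => hP ▸ hx p hp
  · intro w hw
    obtain ⟨p, hp⟩ := D.loop_subset_patch hc hw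
    exact hp.1
  · rw [disjoint_left]
    intro w hw
    obtain ⟨p, hp⟩ := D.loop_subset_patch hc hw
    refine disjoint_left.1 (D.disjoint_patch_pinchArc (fun t q hq => ?_) p) hp
    rw [hP]
    rcases hv.eq_or_eq_of_mem_box hq with rfl | ⟨-, rfl⟩ <;> exact mem_range_self _

end Diagram

/-- The lattice points of a fundamental domain of the periodic knotted path `knotPath`. -/
def knotTable : List (ℤ × ℤ × ℤ) :=
  [(6, 4, 0), (7, 4, 0), (8, 4, 0), (9, 4, 0), (10, 4, 0), (11, 4, 0), (12, 4, 0), (13, 4, 0),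
   (14, 4, 0), (14, 4, 1), (14, 4, 2), (14, 5, 2), (14, 6, 2), (14, 7, 2), (14, 8, 2),
   (14, 9, 2), (14, 10, 2), (14, 11, 2), (14, 12, 2), (14, 12, 1), (14, 12, 0), (15, 12, 0),
   (16, 12, 0), (17, 12, 0), (18, 12, 0), (19, 12, 0), (20, 12, 0), (21, 12, 0), (22, 12, 0),
   (22, 12, 1), (22, 12, 2), (22, 11, 2), (22, 10, 2), (22, 10, 1), (22, 10, 0), (23, 10, 0),
   (24, 10, 0), (25, 10, 0), (26, 10, 0), (27, 10, 0), (28, 10, 0), (28, 10, 1), (28, 10, 2),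
   (28, 9, 2), (28, 8, 2), (28, 7, 2), (28, 6, 2), (28, 6, 1), (28, 6, 0), (27, 6, 0),
   (26, 6, 0), (25, 6, 0), (24, 6, 0), (23, 6, 0), (22, 6, 0), (21, 6, 0), (20, 6, 0),
   (20, 6, 1), (20, 6, 2), (20, 7, 2), (20, 8, 2), (20, 8, 1), (20, 8, 0), (19, 8, 0),
   (18, 8, 0), (17, 8, 0), (16, 8, 0), (16, 8, 1), (16, 8, 2), (16, 7, 2), (16, 6, 2),
   (16, 5, 2), (16, 4, 2), (16, 4, 1)]

/-- A knotted lattice path along the first coordinate axis, invariant under the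
translation by `10`. -/
def knotPath (k : ℤ) : ℤ × ℤ × ℤ :=
  ((knotTable.getD (k % 74).toNat 0).1 + 10 * (k / 74), (knotTable.getD (k % 74).toNat 0).2)

/-- The labels of the regions of the diagram of `knotPath`, on squares of side `2`. -/
def regionTable : List (List (Fin 9)) :=
  [[5, 5, 0, 6, 6, 6, 6, 0, 5, 5],
   [3, 3, 1, 7, 6, 2, 2, 4, 8, 5],
   [3, 3, 1, 1, 2, 2, 2, 4, 4, 3],
   [3, 0, 2, 2, 2, 2, 0, 3, 3, 3]]

/-- The permutations used to label regions. -/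
def regionPerm : Fin 9 → Equiv.Perm (Fin 5) :=
  ![1,
    ⟨![1, 2, 3, 4, 0], ![4, 0, 1, 2, 3], by decide, by decide⟩,
    ⟨![2, 0, 4, 1, 3], ![1, 3, 0, 4, 2], by decide, by decide⟩,
    ⟨![2, 4, 1, 0, 3], ![3, 2, 0, 4, 1], by decide, by decide⟩,
    ⟨![4, 3, 0, 2, 1], ![2, 4, 3, 1, 0], by decide, by decide⟩,
    ⟨![1, 3, 0, 4, 2], ![2, 0, 4, 1, 3], by decide, by decide⟩,
    ⟨![3, 2, 0, 4, 1], ![2, 4, 1, 0, 3], by decide, by decide⟩,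
    ⟨![4, 3, 1, 0, 2], ![3, 2, 4, 1, 0], by decide, by decide⟩,
    ⟨![3, 2, 4, 1, 0], ![4, 3, 1, 0, 2], by decide, by decide⟩]

/-- The index of the label of the square with lowest corner `(i, j)`. -/
def region (i j : ℤ) : Fin 9 :=
  if 4 ≤ j ∧ j < 12 then (regionTable.getD (j / 2 - 2).toNat []).getD (i % 20 / 2).toNat 0 else 0

/-- The points of `knotPath`, described by their reduction modulo `10`. -/
def OnKnot (p : ℤ × ℤ × ℤ) : Prop := (p.1 % 10, p.2) ∈ knotTable.map fun q => (q.1 % 10, q.2)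

instance (p : ℤ × ℤ × ℤ) : Decidable (OnKnot p) := by
  unfold OnKnot
  infer_instance

theorem length_knotTable : knotTable.length = 74 := rfl

theorem onKnot_iff_mem_range (p : ℤ × ℤ × ℤ) : OnKnot p ↔ p ∈ range knotPath := by
  simp only [OnKnot, List.mem_map, mem_range]
  constructor
  · rintro ⟨q, hq, h⟩
    obtain ⟨n, hn, rfl⟩ := List.mem_iff_getElem.1 hq
    rw [length_knotTable] at hn
    obtain ⟨h1, h2⟩ := Prod.ext_iff.1 h
    simp only at h1 h2
    refine ⟨n + 74 * ((p.1 - (knotTable[n]).1) / 10), ?_⟩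
    have e1 : ((n + 74 * ((p.1 - (knotTable[n]).1) / 10)) % 74).toNat = n := by lia
    have e2 : (n + 74 * ((p.1 - (knotTable[n]).1) / 10)) / 74 = (p.1 - (knotTable[n]).1) / 10 := by
      lia
    rw [knotPath, e1, e2, List.getD_eq_getElem _ _ (by rwa [length_knotTable])]
    exact Prod.ext (by dsimp only; lia) h2
  · rintro ⟨k, rfl⟩
    have h : (k % 74).toNat < knotTable.length := by
      rw [length_knotTable]
      lia
    refine ⟨_, List.getElem_mem h, ?_⟩
    simp only [knotPath, List.getD_eq_getElem _ _ h]
    exact Prod.ext (by dsimp only; lia) rfl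

theorem knotPath_add_mul (k q : ℤ) :
    knotPath (k + 74 * q) = ((knotPath k).1 + 10 * q, (knotPath k).2) := by
  have e1 : (k + 74 * q) % 74 = k % 74 := by lia
  have e2 : (k + 74 * q) / 74 = k / 74 + q := by lia
  simp only [knotPath, e1, e2]
  exact Prod.ext (by dsimp only; ring) rfl

theorem taxicab_translate (p q : ℤ × ℤ × ℤ) (a b : ℤ) :
    taxicab (p.1 + a, p.2) (q.1 + b, q.2) = taxicab p (q.1 + (b - a), q.2) := by
  simp only [taxicab]
  congr 3
  ring

theorem taxicab_knotPath_succ_of_lt :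
    ∀ r < 74, taxicab (knotPath (r : ℕ)) (knotPath (r + 1)) = 1 := by
  decide +kernel

theorem abs_sub_le_of_taxicab_knotPath_le_of_lt : ∀ r < 74, ∀ s < 74, ∀ m < 5,
    taxicab (knotPath (r : ℕ)) (knotPath ((s : ℕ) + 74 * ((m : ℕ) - 2))) ≤ 1 →
      |(r : ℤ) - (s + 74 * (m - 2))| ≤ 1 := by
  decide +kernel

theorem knotTable_bounds : ∀ r < 74, 6 ≤ (knotPath (r : ℕ)).1 ∧ (knotPath (r : ℕ)).1 ≤ 28 := by
  decide +kernel

theorem exists_eq_natCast_add_mul (k : ℤ) : ∃ r < 74, ∃ q : ℤ, k = (r : ℕ) + 74 * q :=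
  ⟨(k % 74).toNat, by lia, k / 74, by lia⟩

theorem isInducedPath_knotPath : IsInducedPath knotPath where
  taxicab_succ k := by
    obtain ⟨r, hr, q, rfl⟩ := exists_eq_natCast_add_mul k
    rw [add_right_comm, knotPath_add_mul, knotPath_add_mul, taxicab_translate, sub_self]
    simpa using taxicab_knotPath_succ_of_lt r hr
  abs_sub_le k l h := by
    obtain ⟨r, hr, q, rfl⟩ := exists_eq_natCast_add_mul k
    obtain ⟨s, hs, q', rfl⟩ := exists_eq_natCast_add_mul l
    rw [knotPath_add_mul, knotPath_add_mul, taxicab_translate] at h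
    obtain ⟨h1, h2⟩ := knotTable_bounds r hr
    obtain ⟨h3, h4⟩ := knotTable_bounds s hs
    have h5 : |(knotPath r).1 - ((knotPath s).1 + (10 * q' - 10 * q))| ≤ 1 := by
      refine le_trans ?_ h
      simp only [taxicab]
      linarith [abs_nonneg ((knotPath r).2.1 - (knotPath s).2.1),
        abs_nonneg ((knotPath r).2.2 - (knotPath s).2.2)]
    obtain ⟨h6, h7⟩ := abs_le.1 h5
    obtain ⟨m, hm, hmq⟩ : ∃ m : ℕ, m < 5 ∧ q' - q = m - 2 :=
      ⟨(q' - q + 2).toNat, by lia, by lia⟩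
    have e : 10 * q' - 10 * q = 10 * ((m : ℤ) - 2) := by rw [← hmq, mul_sub]
    have h8 := abs_sub_le_of_taxicab_knotPath_le_of_lt r hr s hs m hm
    rw [knotPath_add_mul, ← e] at h8
    rw [show (r + 74 * q - (s + 74 * q') : ℤ) = r - (s + 74 * (m - 2)) by lia]
    exact h8 h

theorem region_emod (i j : ℤ) : region (i % 20) j = region i j := by
  simp [region]

theorem region_eq_zero {i j : ℤ} (h : ¬ (4 ≤ j ∧ j < 12)) : region i j = 0 := if_neg h

theorem onKnot_emod (i : ℤ) (p : ℤ × ℤ) : OnKnot (i % 20, p) ↔ OnKnot (i, p) := by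
  have h : i % 20 % 10 = i % 10 := by lia
  simp only [OnKnot, h]

/-- The labels around `(i, j)` satisfy the conditions for a diagram. -/
def LabelsMatch (i j : ℤ) : Prop :=
  (region i j = region i (j - 1) ∨ OnKnot (i, j, 0) ∧ OnKnot (i + 1, j, 0)) ∧
  (region i j = region (i - 1) j ∨ OnKnot (i, j, 2) ∧ OnKnot (i, j + 1, 2)) ∧
  ((regionPerm (region i j))⁻¹ * regionPerm (region (i - 1) j) =
    (regionPerm (region i (j - 1)))⁻¹ * regionPerm (region (i - 1) (j - 1)) ∨ OnKnot (i, j, 1))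

instance (i j : ℤ) : Decidable (LabelsMatch i j) := by
  unfold LabelsMatch
  infer_instance

theorem labelsMatch_of_mem : ∀ i ∈ Finset.Ico (0 : ℤ) 20, ∀ j ∈ Finset.Ico (4 : ℤ) 13,
    LabelsMatch i j := by
  decide +kernel

theorem labelsMatch_emod (i j : ℤ) : LabelsMatch (i % 20) j ↔ LabelsMatch i j := by
  have h1 : ∀ j, region (i % 20 - 1) j = region (i - 1) j := fun j => by
    rw [← region_emod, Int.emod_sub_emod, region_emod]
  have h2 : OnKnot (i % 20 + 1, j, 0) ↔ OnKnot (i + 1, j, 0) := by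
    rw [← onKnot_emod, Int.emod_add_emod, onKnot_emod]
  simp only [LabelsMatch, region_emod, onKnot_emod, h1, h2]

theorem labelsMatch (i j : ℤ) : LabelsMatch i j := by
  by_cases hj : 4 ≤ j ∧ j < 13
  · rw [← labelsMatch_emod]
    exact labelsMatch_of_mem _ (Finset.mem_Ico.2 (by lia)) _ (Finset.mem_Ico.2 hj)
  · have h1 : ∀ i, region i j = 0 := fun i => region_eq_zero (by lia)
    have h2 : ∀ i, region i (j - 1) = 0 := fun i => region_eq_zero (by lia)
    simp [LabelsMatch, h1, h2]

/-- The diagram of `knotPath`. -/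
def knotDiagram : Diagram (Equiv.Perm (Fin 5)) where
  P := range knotPath
  γ i j := regionPerm (region i j)
  eq_below i j := by
    simp only [← onKnot_iff_mem_range]
    exact (labelsMatch i j).1.imp_left (congrArg regionPerm)
  eq_left i j := by
    simp only [← onKnot_iff_mem_range]
    exact (labelsMatch i j).2.1.imp_left (congrArg regionPerm)
  inv_mul_eq i j := by
    rw [← onKnot_iff_mem_range]
    exact (labelsMatch i j).2.2
  eq_one i j hj := by
    rw [region_eq_zero (by rintro ⟨h1, h2⟩; rw [le_abs] at hj; lia)]
    rfl

theorem exists_norm_latticePoint_knotPath_sub_le :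
    ∃ K : ℝ, ∀ k : ℤ, ‖latticePoint (knotPath k) - ((10 / 74 : ℝ) * k) • axis‖ ≤ K := by
  refine ⟨∑ r ∈ Finset.range 74,
    ‖latticePoint (knotPath (r : ℕ)) - ((10 / 74 : ℝ) * ((r : ℤ) : ℝ)) • axis‖, fun k => ?_⟩
  obtain ⟨r, hr, q, rfl⟩ := exists_eq_natCast_add_mul k
  have h : latticePoint (knotPath (r + 74 * q)) =
      latticePoint (knotPath r) + (10 * q : ℝ) • axis := by
    rw [knotPath_add_mul]
    exact point_ext (by simp [latticePoint]) (by simp [latticePoint, axis])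
      (by simp [latticePoint, axis])
  have e : latticePoint (knotPath (r + 74 * q)) - ((10 / 74 : ℝ) * ((r + 74 * q : ℤ) : ℝ)) • axis =
      latticePoint (knotPath r) - ((10 / 74 : ℝ) * ((r : ℤ) : ℝ)) • axis := by
    rw [h]
    push_cast
    module
  rw [e]
  exact Finset.single_le_sum (f := fun r : ℕ => ‖latticePoint (knotPath (r : ℤ)) -
    ((10 / 74 : ℝ) * ((r : ℤ) : ℝ)) • axis‖) (fun _ _ => norm_nonneg _) (Finset.mem_range.2 hr)

/-- There is an arc (a compact set homeomorphic to the unit interval) in `ℝ³` that is not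
an attractor for any discrete dynamical system on any open subset of `ℝ³`. -/
theorem exists_arc_not_attractor :
    ∃ A : Set R3, IsCompact A ∧ Nonempty (↥A ≃ₜ ↥(Set.Icc (0 : ℝ) 1)) ∧
      ∀ U : Set R3, IsOpen U → A ⊆ U →
        ∀ f : ↥U → ↥U, Continuous f → Function.Injective f → ¬ IsAttractor f A := by
  obtain ⟨K, hK⟩ := exists_norm_latticePoint_knotPath_sub_le
  refine knotDiagram.exists_arc_of_isInducedPath isInducedPath_knotPath rfl (by norm_num) hK
    (i := 1) (j := 4) (fun a => ?_) ?_
  · change _ ∉ range knotPath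
    rw [← onKnot_iff_mem_range]
    revert a
    decide +kernel
  · change regionPerm (region 1 4) ≠ regionPerm (region 1 (4 - 1))
    decide +kernel
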